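/- Suppose t = (√6/(2π))√n·log n + (√6/π)·M·√n for some 0 ≤ M ≤ 10·log n. Then the number of t-core partitions of n is at least p(n)·(1 − O(log(n)/e^M)), where the implied constant is absolute. -/

import Mathlib

open Real

def rowLen {n : ℕ} (μ : Nat.Partition n) (i : ℕ) : ℕ :=
  ((μ.parts.sort (· ≤ ·)).reverse).getD i 0

def colLen {n : ℕ} (μ : Nat.Partition n) (j : ℕ) : ℕ :=
  (μ.parts.filter (fun a => j < a)).card

def hookLen {n : ℕ} (μ : Nat.Partition n) (i j : ℕ) : ℕ :=
  (rowLen μ i - j) + (colLen μ j - i) - 1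

/-- `μ` is a `t`-core: no hook length of `μ` is divisible by `t`. -/
def IsTCore {n : ℕ} (t : ℕ) (μ : Nat.Partition n) : Prop :=
  ∀ i j, j < rowLen μ i → ¬ t ∣ hookLen μ i j


section GF
open PowerSeries

theorem gf_eval_mul (z : ℂ) (f g : PowerSeries ℂ) (u v : ℂ)
    (hf : HasSum (fun k => coeff k f * z ^ k) u) (hg : HasSum (fun k => coeff k g * z ^ k) v) :
    HasSum (fun k => coeff k (f * g) * z ^ k) (u * v) := by
  have hf' := hf.summable.norm
  have hg' := hg.summable.norm
  have h1 := summable_norm_sum_mul_antidiagonal_of_summable_norm hf' hg'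
  have h2 := tsum_mul_tsum_eq_tsum_sum_antidiagonal_of_summable_norm hf' hg'
  have e : (fun k => coeff k (f * g) * z ^ k) = fun n => ∑ kl ∈ Finset.HasAntidiagonal.antidiagonal n,
      (coeff kl.1 f * z ^ kl.1) * (coeff kl.2 g * z ^ kl.2) := by
    funext n
    rw [coeff_mul, Finset.sum_mul]
    refine Finset.sum_congr rfl fun p hp => ?_
    rw [← Finset.HasAntidiagonal.mem_antidiagonal.mp hp, pow_add]; ring
  rw [e, ← hf.tsum_eq, ← hg.tsum_eq, h2]
  exact (Summable.of_norm h1).hasSum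

theorem gf_eval_geom (z : ℂ) (hz : ‖z‖ < 1) (m : ℕ) (hm : 0 < m) :
    HasSum (fun k => coeff k (PowerSeries.mk (fun k => if m ∣ k then (1:ℂ) else 0)) * z ^ k)
      (1 - z ^ m)⁻¹ := by
  have h1 : ‖z ^ m‖ < 1 := by
    rw [norm_pow]; exact pow_lt_one₀ (norm_nonneg _) hz hm.ne'
  have h2 := hasSum_geometric_of_norm_lt_one h1
  have inj : Function.Injective (fun j : ℕ => m * j) := fun a b h => Nat.eq_of_mul_eq_mul_left hm h
  refine (inj.hasSum_iff ?_).mp ?_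
  · intro k hk
    have : ¬ m ∣ k := fun ⟨j, hj⟩ => hk ⟨j, hj.symm⟩
    simp [this]
  · refine h2.congr_fun ?_
    intro j
    simp [pow_mul]

theorem gf_geom_eq (m : ℕ) (hm : 0 < m) [TopologicalSpace (PowerSeries ℂ)] [T2Space (PowerSeries ℂ)] (f : PowerSeries ℂ)
    (hf : f * (1 - X ^ m) = 1) :
    f = (PowerSeries.mk (fun k => if m ∣ k then (1:ℂ) else 0)) := by
  have h : (PowerSeries.mk (fun k => if m ∣ k then (1:ℂ) else 0)) * (1 - X ^ m) = 1 := by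
    ext k
    rw [mul_sub, mul_one, map_sub, coeff_mul_X_pow', coeff_mk, coeff_one]
    by_cases hk : m ≤ k
    · have hk0 : k ≠ 0 := by omega
      have : (m ∣ k - m) ↔ m ∣ k := by
        constructor
        · intro h; have := Nat.dvd_add h (dvd_refl m); rwa [Nat.sub_add_cancel hk] at this
        · intro h; exact Nat.dvd_sub h (dvd_refl m)
      simp [this, hk, hk0]
    · have : m ∣ k ↔ k = 0 := by
        constructor
        · intro h; by_contra h0; exact hk (Nat.le_of_dvd (Nat.pos_of_ne_zero h0) h)
        · rintro rfl; simp
      simp [this, hk]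
  calc f = f * ((PowerSeries.mk (fun k => if m ∣ k then (1:ℂ) else 0)) * (1 - X ^ m)) := by
        rw [h, mul_one]
    _ = (f * (1 - X^m)) * (PowerSeries.mk (fun k => if m ∣ k then (1:ℂ) else 0)) := by ring
    _ = _ := by rw [hf, one_mul]

open scoped PowerSeries.WithPiTopology in
theorem gf_restricted (N : ℕ) :
    (PowerSeries.mk fun n ↦ (((Nat.Partition.restricted n (· ≤ N)).card : ℕ) : ℂ)) =
      ∏ i ∈ Finset.range N, (PowerSeries.mk (fun k => if (i+1) ∣ k then (1:ℂ) else 0)) := by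
  have h1 := Nat.Partition.hasProd_powerSeriesMk_card_restricted ℂ (· ≤ N)
  have h2 := hasProd_prod_of_ne_finset_one (L := SummationFilter.unconditional ℕ) (s := Finset.range N)
    (f := fun i ↦ if i + 1 ≤ N then ∑' j : ℕ, (X : PowerSeries ℂ) ^ ((i + 1) * j) else 1) (by
      intro b hb; rw [if_neg]; simpa using hb)
  rw [h1.unique h2]
  refine Finset.prod_congr rfl fun i hi => ?_
  rw [if_pos (by simpa using hi)]
  apply gf_geom_eq _ (Nat.succ_pos i)
  simp_rw [pow_mul]
  apply PowerSeries.WithPiTopology.tsum_pow_mul_one_sub_of_constantCoeff_eq_zero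
  simp

theorem gf_main (N : ℕ) : ∃ a : ℕ → ℝ, (∀ k, 0 ≤ a k) ∧
    (∀ k ≤ N, a k = (Nat.card (Nat.Partition k) : ℝ)) ∧ ∀ z : ℂ, ‖z‖ < 1 →
      HasSum (fun k => (a k : ℂ) * z ^ k) (∏ i ∈ Finset.range N, (1 - z ^ (i+1))⁻¹) := by
  refine ⟨fun k => ((Nat.Partition.restricted k (· ≤ N)).card : ℝ), fun k => by positivity, ?_, ?_⟩
  · intro k hk
    rw [Nat.card_eq_fintype_card, ← Finset.card_univ]
    have : Nat.Partition.restricted k (· ≤ N) = Finset.univ := ?_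
    · show ((Nat.Partition.restricted k (· ≤ N)).card : ℝ) = _
      rw [this]
    ext μ
    simp only [Nat.Partition.restricted, Finset.mem_filter, Finset.mem_univ, true_and, iff_true]
    intro i hi
    exact (Nat.Partition.le_of_mem_parts hi).trans hk
  · intro z hz
    have key : ∀ s : Finset ℕ, HasSum (fun k => coeff k (∏ i ∈ s, (PowerSeries.mk (fun k => if (i+1) ∣ k then (1:ℂ) else 0))) * z ^ k)
        (∏ i ∈ s, (1 - z ^ (i+1))⁻¹) := by
      intro s
      induction s using Finset.induction_on with
      | empty =>
        simp only [Finset.prod_empty]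
        convert hasSum_single (f := fun k => coeff k (1 : PowerSeries ℂ) * z ^ k) 0 ?_ using 1
        · simp
        · intro b hb; simp [coeff_one, hb]
      | insert a s ha ih =>
        rw [Finset.prod_insert ha, Finset.prod_insert ha]
        exact gf_eval_mul z _ _ _ _ (gf_eval_geom z hz _ (Nat.succ_pos a)) ih
    have := key (Finset.range N)
    rw [← gf_restricted] at this
    simpa using this
end GF


section FO
open MeasureTheory

theorem fo_orth (k j : ℕ) :
    ∫ θ in (-π)..π, Complex.exp ((k:ℂ) * (θ * Complex.I)) * Complex.exp (-((j:ℂ) * (θ * Complex.I)))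
      = if k = j then (2 * π : ℂ) else 0 := by
  have e : ∀ θ : ℝ, Complex.exp ((k:ℂ) * (θ * Complex.I)) * Complex.exp (-((j:ℂ) * (θ * Complex.I)))
      = Complex.exp ((((k:ℂ) - j) * Complex.I) * θ) := by
    intro θ; rw [← Complex.exp_add]; congr 1; ring
  simp_rw [e]
  split_ifs with h
  · subst h; simp; ring
  · have h0 : ((k:ℂ) - j) ≠ 0 := by
      rw [sub_ne_zero]; exact_mod_cast h
    rw [integral_exp_mul_complex (mul_ne_zero h0 Complex.I_ne_zero)]
    have : Complex.exp (((k:ℂ) - j) * Complex.I * (π:ℝ)) = Complex.exp (((k:ℂ) - j) * Complex.I * ((-π:ℝ):ℂ)) := by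
      rw [Complex.exp_eq_exp_iff_exists_int]
      refine ⟨(k:ℤ) - j, ?_⟩
      push_cast; ring
    rw [this]; simp

theorem fo_coeff (a : ℕ → ℝ) (G : ℂ → ℂ)
    (h : ∀ z : ℂ, ‖z‖ < 1 → HasSum (fun k => (a k : ℂ) * z ^ k) (G z)) (x : ℝ) (hx : 0 < x) (j : ℕ) :
    ∫ θ in (-π)..π, G (Complex.exp (-x + θ * Complex.I)) * Complex.exp (-((j:ℂ) * (θ * Complex.I)))
      = 2 * π * a j * Real.exp (-(x * j)) := by
  have hn : ∀ θ : ℝ, ‖Complex.exp (-x + θ * Complex.I)‖ < 1 := by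
    intro θ; rw [Complex.norm_exp]; simp [hx]
  have hp : ∀ (θ : ℝ) (k : ℕ), Complex.exp (-x + θ * Complex.I) ^ k
      = (Real.exp (-(x * k)) : ℂ) * Complex.exp ((k:ℂ) * (θ * Complex.I)) := by
    intro θ k
    rw [← Complex.exp_nat_mul, Complex.ofReal_exp, ← Complex.exp_add]; congr 1; push_cast; ring
  have hs : Summable (fun k : ℕ => |a k| * Real.exp (-(x * k))) := by
    have := (h _ (hn 0)).summable.norm
    refine this.congr fun k => ?_
    rw [hp 0 k]; simp [Complex.norm_exp]
  have key := intervalIntegral.hasSum_integral_of_dominated_convergence (μ := volume) (a := -π) (b := π)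
    (F := fun (k : ℕ) (θ : ℝ) => (a k * Real.exp (-(x * k)) : ℂ) *
      (Complex.exp ((k:ℂ) * (θ * Complex.I)) * Complex.exp (-((j:ℂ) * (θ * Complex.I)))))
    (f := fun θ => G (Complex.exp (-x + θ * Complex.I)) * Complex.exp (-((j:ℂ) * (θ * Complex.I))))
    (fun k _ => |a k| * Real.exp (-(x * k)))
    (fun k => by
      apply Continuous.aestronglyMeasurable; fun_prop)
    (fun k => by
      filter_upwards with θ _
      simp [Complex.norm_exp])
    (by filter_upwards with θ _; exact hs)
    (by simp)
    (by
      filter_upwards with θ _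
      have := (h _ (hn θ)).mul_right (Complex.exp (-((j:ℂ) * (θ * Complex.I))))
      refine this.congr_fun fun k => ?_
      rw [hp]; push_cast; ring)
  have e2 : ∀ k : ℕ, ∫ θ in (-π)..π, (a k * Real.exp (-(x * k)) : ℂ) *
      (Complex.exp ((k:ℂ) * (θ * Complex.I)) * Complex.exp (-((j:ℂ) * (θ * Complex.I)))) =
      if k = j then (2 * π * a j * Real.exp (-(x * j)) : ℂ) else 0 := by
    intro k
    rw [intervalIntegral.integral_const_mul, fo_orth]
    split_ifs with hk
    · subst hk; ring
    · simp
  simp_rw [e2] at key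
  refine key.unique ?_
  exact hasSum_ite_eq j _

end FO

section PSI

/-- weights of the logarithmic expansion -/
noncomputable def wt (x : ℝ) (i k : ℕ) : ℝ := Real.exp (-(x * ((i + 1) * (k + 1))))

noncomputable def Psi (x : ℝ) (N : ℕ) (θ : ℝ) : ℂ :=
  ∑ i ∈ Finset.range N, ∑' k : ℕ, ((wt x i k / (k + 1) : ℝ) : ℂ) *
    (Complex.exp (Complex.I * ((θ * ((i + 1) * (k + 1)) : ℝ) : ℂ)) - 1)

theorem wt_pow (x : ℝ) (i k : ℕ) : wt x i k = Real.exp (-(x * (i + 1))) ^ (k + 1) := by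
  rw [wt, ← Real.exp_nat_mul]; congr 1; push_cast; ring

theorem summable_poly_wt (x : ℝ) (hx : 0 < x) (i r : ℕ) :
    Summable (fun k : ℕ => ((k : ℝ) + 1) ^ r * wt x i k) := by
  have h1 : Real.exp (-(x * (i + 1))) < 1 := by
    rw [Real.exp_lt_one_iff]; have : 0 < x * (i+1) := by positivity
    linarith
  have := summable_pow_mul_geometric_of_norm_lt_one (R := ℝ) r (r := Real.exp (-(x * (i + 1))))
    (by rwa [Real.norm_of_nonneg (Real.exp_nonneg _)])
  have := (summable_nat_add_iff 1).mpr this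
  refine this.congr fun k => ?_
  rw [wt_pow]; push_cast; ring

theorem wt_pos (x : ℝ) (i k : ℕ) : 0 < wt x i k := Real.exp_pos _

theorem summable_wt_div (x : ℝ) (hx : 0 < x) (i : ℕ) :
    Summable (fun k : ℕ => wt x i k / ((k : ℝ) + 1)) := by
  refine Summable.of_nonneg_of_le (fun k => ?_) (fun k => ?_) (summable_poly_wt x hx i 0)
  · have := wt_pos x i k; positivity
  · rw [pow_zero, one_mul]; exact div_le_self (wt_pos x i k).le (by linarith [(Nat.cast_nonneg k : (0:ℝ) ≤ k)])

theorem psi_summable (x : ℝ) (hx : 0 < x) (i : ℕ) (θ : ℝ) :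
    Summable (fun k : ℕ => ((wt x i k / (k + 1) : ℝ) : ℂ) *
    (Complex.exp (Complex.I * ((θ * ((i + 1) * (k + 1)) : ℝ) : ℂ)) - 1)) := by
  refine Summable.of_norm_bounded ((summable_wt_div x hx i).mul_right 2) fun k => ?_
  rw [norm_mul, Complex.norm_real, Real.norm_of_nonneg (by have := wt_pos x i k; positivity)]
  have := wt_pos x i k
  gcongr
  refine (norm_sub_le _ _).trans ?_
  rw [Complex.norm_exp]; simp; norm_num

theorem psi_factor (x : ℝ) (hx : 0 < x) (i : ℕ) (θ : ℝ) :
    (1 - Complex.exp (-x + θ * Complex.I) ^ (i+1))⁻¹ =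
      ((1 - Real.exp (-(x * (i+1))) : ℝ) : ℂ)⁻¹ * Complex.exp (∑' k : ℕ, ((wt x i k / (k + 1) : ℝ) : ℂ) *
    (Complex.exp (Complex.I * ((θ * ((i + 1) * (k + 1)) : ℝ) : ℂ)) - 1)) := by
  have h1 : Real.exp (-(x * (i + 1))) < 1 := by
    rw [Real.exp_lt_one_iff]; have : 0 < x * (i+1) := by positivity
    linarith
  have hz : ‖Complex.exp (-x + θ * Complex.I) ^ (i+1)‖ < 1 := by
    rw [norm_pow, Complex.norm_exp, ← Real.exp_nat_mul]
    convert h1 using 2; simp; ring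
  have hw : ‖((Real.exp (-(x * (i+1))) : ℝ) : ℂ)‖ < 1 := by
    rw [Complex.norm_real, Real.norm_of_nonneg (Real.exp_nonneg _)]; exact h1
  have A := Complex.hasSum_taylorSeries_neg_log' hz
  have B := Complex.hasSum_taylorSeries_neg_log' hw
  have hh := (A.sub B).tsum_eq
  have e : ∀ k : ℕ, ((wt x i k / (k + 1) : ℝ) : ℂ) *
    (Complex.exp (Complex.I * ((θ * ((i + 1) * (k + 1)) : ℝ) : ℂ)) - 1) =
      (Complex.exp (-x + θ * Complex.I) ^ (i+1)) ^ (k + 1) / (k + 1) -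
      ((Real.exp (-(x * (i+1))) : ℝ) : ℂ) ^ (k + 1) / (k+1) := by
    intro k
    have : (Complex.exp (-x + θ * Complex.I) ^ (i+1)) ^ (k + 1) =
      ((Real.exp (-(x * (i+1))) : ℝ) : ℂ) ^ (k + 1) * Complex.exp (Complex.I * ((θ * ((i + 1) * (k + 1)) : ℝ) : ℂ)) := by
      rw [Complex.ofReal_exp, ← Complex.exp_nat_mul, ← Complex.exp_nat_mul, ← Complex.exp_nat_mul, ← Complex.exp_add]
      congr 1; push_cast; ring
    rw [this, wt_pow]; push_cast; ring
  simp_rw [e]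
  rw [hh]
  have n1 : 1 - Complex.exp (-x + θ * Complex.I) ^ (i+1) ≠ 0 := by
    intro h; rw [sub_eq_zero] at h; rw [← h] at hz; simp at hz
  have n2 : 1 - ((Real.exp (-(x * (i+1))) : ℝ) : ℂ) ≠ 0 := by
    intro h; rw [sub_eq_zero] at h; rw [← h] at hw; simp at hw
  rw [sub_neg_eq_add, Complex.exp_add (-Complex.log _), Complex.exp_neg (Complex.log _), Complex.exp_log n1, Complex.exp_log n2]
  push_cast at n2 ⊢
  field_simp

theorem psi_prod (x : ℝ) (hx : 0 < x) (N : ℕ) (θ : ℝ) :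
    ∏ i ∈ Finset.range N, (1 - Complex.exp (-x + θ * Complex.I) ^ (i+1))⁻¹ =
      ((∏ i ∈ Finset.range N, (1 - Real.exp (-(x * (i+1))))⁻¹ : ℝ) : ℂ) * Complex.exp (Psi x N θ) := by
  rw [Psi, Complex.exp_sum]
  push_cast
  rw [← Finset.prod_mul_distrib]
  refine Finset.prod_congr rfl fun i _ => ?_
  rw [psi_factor x hx]; push_cast; rfl

theorem psi_re (x : ℝ) (hx : 0 < x) (N : ℕ) (θ : ℝ) :
    (Psi x N θ).re ≤ - ∑ i ∈ Finset.range N, Real.exp (-(x * (i+1))) * (1 - Real.cos (θ * (i+1))) := by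
  rw [Psi, Complex.re_sum, ← Finset.sum_neg_distrib]
  refine Finset.sum_le_sum fun i _ => ?_
  have hs := psi_summable x hx i θ
  rw [Complex.re_tsum hs]
  have hs' := Complex.hasSum_re hs.hasSum
  have e : ∀ k : ℕ, (((wt x i k / (k + 1) : ℝ) : ℂ) *
    (Complex.exp (Complex.I * ((θ * ((i + 1) * (k + 1)) : ℝ) : ℂ)) - 1)).re =
      - (wt x i k / (k + 1) * (1 - Real.cos (θ * ((i + 1) * (k + 1))))) := by
    intro k
    rw [Complex.re_ofReal_mul, Complex.sub_re, mul_comm Complex.I, Complex.exp_ofReal_mul_I_re]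
    simp only [Complex.one_re]; ring
  have hss := hs'.summable
  simp_rw [e] at hss ⊢
  rw [tsum_neg, neg_le_neg_iff]
  have := hss.neg.le_tsum 0 (fun k _ => ?_)
  · simp only [neg_neg] at this
    refine le_trans (le_of_eq ?_) this
    rw [wt_pow]; simp
  · simp only [neg_neg]
    have := wt_pos x i k
    have := Real.cos_le_one (θ * ((i + 1) * (k + 1)))
    apply mul_nonneg <;> [positivity; linarith]

theorem exp_taylor3 (u : ℝ) : ‖Complex.exp (Complex.I * u) - 1 - Complex.I * u + (u:ℂ)^2/2‖ ≤ 4 * |u| ^ 3 := by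
  by_cases hu : |u| ≤ 1
  · have hn : ‖Complex.I * (u:ℂ)‖ = |u| := by simp
    have := Complex.exp_bound (x := Complex.I * u) (by rw [hn]; exact hu) (n := 3) (by norm_num)
    rw [hn] at this
    have e : Complex.exp (Complex.I * u) - ∑ m ∈ Finset.range 3, (Complex.I * u) ^ m / (m.factorial : ℂ) =
      Complex.exp (Complex.I * u) - 1 - Complex.I * u + (u:ℂ)^2/2 := by
      simp [Finset.sum_range_succ, mul_pow]; ring
    rw [e] at this
    refine this.trans ?_
    have h3 : 0 ≤ |u|^3 := by positivity
    norm_num [Nat.factorial]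
    nlinarith
  · push Not at hu
    have h1 : ‖Complex.exp (Complex.I * u) - 1‖ ≤ 2 := by
      refine (norm_sub_le _ _).trans ?_
      rw [Complex.norm_exp]; simp; norm_num
    have h2 : ‖Complex.exp (Complex.I * u) - 1 - Complex.I * u + (u:ℂ)^2/2‖ ≤ 2 + |u| + |u|^2/2 := by
      refine (norm_add_le _ _).trans (add_le_add ((norm_sub_le _ _).trans (add_le_add h1 ?_)) ?_)
      · simp
      · simp
    have : |u|^2 ≤ |u|^3 := pow_le_pow_right₀ hu.le (by norm_num)
    have : |u|^1 ≤ |u|^3 := pow_le_pow_right₀ hu.le (by norm_num)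
    have : |u|^0 ≤ |u|^3 := pow_le_pow_right₀ hu.le (by norm_num)
    simp at *
    linarith

/-- moment sums -/
noncomputable def Mom (x : ℝ) (N r : ℕ) : ℝ :=
  ∑ i ∈ Finset.range N, ∑' k : ℕ, ((i:ℝ)+1)^(r+1) * (((k:ℝ) + 1) ^ r * wt x i k)

theorem psi_taylor (x : ℝ) (hx : 0 < x) (N : ℕ) (θ : ℝ) :
    ‖Psi x N θ - Complex.I * ((θ * Mom x N 0 : ℝ) : ℂ) + ((θ^2/2 * Mom x N 1 : ℝ) : ℂ)‖ ≤ 4 * |θ|^3 * Mom x N 2 := by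
  have hm : ∀ r i : ℕ, Summable (fun k : ℕ => ((i:ℝ)+1)^(r+1) * (((k:ℝ) + 1) ^ r * wt x i k)) :=
    fun r i => (summable_poly_wt x hx i r).mul_left _
  have hmc : ∀ r i : ℕ, HasSum (fun k : ℕ => ((((i:ℝ)+1)^(r+1) * (((k:ℝ) + 1) ^ r * wt x i k) : ℝ) : ℂ))
     ((∑' k : ℕ, (((i:ℝ)+1)^(r+1) * (((k:ℝ) + 1) ^ r * wt x i k)) : ℝ) : ℂ) :=
    fun r i => Complex.hasSum_ofReal.mpr (hm r i).hasSum
  have e : Psi x N θ - Complex.I * ((θ * Mom x N 0 : ℝ) : ℂ) + ((θ^2/2 * Mom x N 1 : ℝ) : ℂ) =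
     ∑ i ∈ Finset.range N, ((∑' k : ℕ, ((wt x i k / (k + 1) : ℝ) : ℂ) *
    (Complex.exp (Complex.I * ((θ * ((i + 1) * (k + 1)) : ℝ) : ℂ)) - 1)) -
       Complex.I * θ * ((∑' k : ℕ, (((i:ℝ)+1)^(0+1) * (((k:ℝ) + 1) ^ 0 * wt x i k)) : ℝ) : ℂ)
       + ((θ^2/2:ℝ):ℂ) * ((∑' k : ℕ, (((i:ℝ)+1)^(1+1) * (((k:ℝ) + 1) ^ 1 * wt x i k)) : ℝ) : ℂ)) := by
    rw [Finset.sum_add_distrib, Finset.sum_sub_distrib, ← Finset.mul_sum, ← Finset.mul_sum, Psi, Mom, Mom]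
    push_cast; ring
  rw [e, Mom, Finset.mul_sum]
  refine (norm_sum_le _ _).trans (Finset.sum_le_sum fun i _ => ?_)
  have H := (((psi_summable x hx i θ).hasSum.sub ((hmc 0 i).mul_left (Complex.I * θ))).add
    ((hmc 1 i).mul_left ((θ^2/2:ℝ):ℂ)))
  rw [← H.tsum_eq, ← tsum_mul_left]
  refine tsum_of_norm_bounded ((hm 2 i).mul_left _).hasSum fun k => ?_
  have hk : (0:ℝ) < k + 1 := by positivity
  have hkc : (k:ℂ) + 1 ≠ 0 := by exact_mod_cast hk.ne'
  have e2 : ((wt x i k / (k + 1) : ℝ) : ℂ) *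
    (Complex.exp (Complex.I * ((θ * ((i + 1) * (k + 1)) : ℝ) : ℂ)) - 1) -
     Complex.I * θ * ((((i:ℝ)+1)^(0+1) * (((k:ℝ) + 1) ^ 0 * wt x i k) : ℝ) : ℂ) +
     ((θ^2/2:ℝ):ℂ) * ((((i:ℝ)+1)^(1+1) * (((k:ℝ) + 1) ^ 1 * wt x i k) : ℝ) : ℂ) =
     ((wt x i k / (k + 1) : ℝ) : ℂ) *
    (Complex.exp (Complex.I * ((θ * ((i + 1) * (k + 1)) : ℝ) : ℂ)) - 1 -
      Complex.I * ((θ * ((i + 1) * (k + 1)) : ℝ) : ℂ) + ((θ * ((i + 1) * (k + 1)) : ℝ) : ℂ)^2/2) := by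
    push_cast
    field_simp
  rw [e2, norm_mul, Complex.norm_real, Real.norm_of_nonneg (by have := wt_pos x i k; positivity)]
  refine (mul_le_mul_of_nonneg_left (exp_taylor3 _) (by have := wt_pos x i k; positivity)).trans (le_of_eq ?_)
  rw [abs_mul, abs_of_pos (by positivity : (0:ℝ) < (i+1)*(k+1))]
  field_simp

end PSI


section MOM

theorem zeta2_shift : HasSum (fun k : ℕ => 1 / ((k:ℝ) + 1) ^ 2) (π ^ 2 / 6) := by
  have := (hasSum_nat_add_iff (f := fun n : ℕ => 1 / (n:ℝ) ^ 2) 1 (g := π^2/6)).mpr (by simpa using hasSum_zeta_two)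
  simpa using this

theorem zeta2_tail (K : ℕ) : π ^ 2 / 6 - 1 / ((K:ℝ) + 1) ≤ ∑ k ∈ Finset.range (K+1), 1 / ((k:ℝ) + 1) ^ 2 := by
  have anti : Antitone (fun K : ℕ => ∑ k ∈ Finset.range (K+1), 1 / ((k:ℝ) + 1) ^ 2 + 1 / ((K:ℝ) + 1)) := by
    refine antitone_nat_of_succ_le fun K => ?_
    rw [Finset.sum_range_succ _ (K+1)]
    push_cast
    have : (1:ℝ) / ((K:ℝ)+1+1)^2 + 1 / ((K:ℝ)+1+1) ≤ 1 / ((K:ℝ)+1) := by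
      rw [div_add_div _ _ (by positivity) (by positivity), div_le_div_iff₀ (by positivity) (by positivity)]
      have : (0:ℝ) ≤ K := Nat.cast_nonneg K
      nlinarith [mul_nonneg this this, mul_nonneg this (mul_nonneg this this)]
    linarith
  have lim : Filter.Tendsto (fun K : ℕ => ∑ k ∈ Finset.range (K+1), 1 / ((k:ℝ) + 1) ^ 2 + 1 / ((K:ℝ) + 1))
      Filter.atTop (nhds (π^2/6 + 0)) := by
    refine Filter.Tendsto.add ?_ tendsto_one_div_add_atTop_nhds_zero_nat
    exact zeta2_shift.tendsto_sum_nat.comp (Filter.tendsto_add_atTop_nat 1)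
  have := anti.le_of_tendsto lim K
  linarith

theorem geom_exp_le (y : ℝ) (hy : 0 < y) (N : ℕ) :
    ∑ i ∈ Finset.range N, Real.exp (-(y * (i+1))) ≤ 1 / y := by
  have h1 : Real.exp (-y) < 1 := by rw [Real.exp_lt_one_iff]; linarith
  have hs := (hasSum_geometric_of_lt_one (Real.exp_pos (-y)).le h1).mul_left (Real.exp (-y))
  have e : ∀ i : ℕ, Real.exp (-(y * (i+1))) = Real.exp (-y) * Real.exp (-y) ^ i := by
    intro i; rw [← Real.exp_nat_mul, ← Real.exp_add]; congr 1; ring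
  simp_rw [e]
  refine (hs.summable.sum_le_tsum _ (fun i _ => by positivity)).trans ?_
  rw [hs.tsum_eq]
  have h2 : 0 < 1 - Real.exp (-y) := by linarith
  rw [← div_eq_mul_inv, div_le_div_iff₀ h2 hy]
  have := Real.add_one_le_exp y
  have h3 : Real.exp (-y) * Real.exp y = 1 := by rw [← Real.exp_add]; simp
  nlinarith [Real.exp_pos (-y)]

theorem pow_exp_le (s : ℕ) (y : ℝ) (hy : 0 < y) (N : ℕ) :
    ∑ i ∈ Finset.range N, ((i:ℝ)+1)^s * Real.exp (-(y * (i+1))) ≤ s.factorial * 2 ^ (s+1) / y ^ (s+1) := by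
  have h : ∀ i : ℕ, ((i:ℝ)+1)^s * Real.exp (-(y * (i+1))) ≤ s.factorial * (2 / y)^s * Real.exp (-(y/2 * (i+1))) := by
    intro i
    have h1 := Real.pow_div_factorial_le_exp (y/2*(i+1)) (by positivity) s
    have h2 : Real.exp (-(y * (i+1))) = Real.exp (-(y/2 * (i+1))) * Real.exp (-(y/2 * (i+1))) := by
      rw [← Real.exp_add]; congr 1; ring
    have h3 : ((i:ℝ)+1)^s * Real.exp (-(y/2 * (i+1))) ≤ s.factorial * (2 / y)^s := by
      rw [Real.exp_neg, ← div_eq_mul_inv, div_le_iff₀ (Real.exp_pos _)]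
      have hf : (0:ℝ) < s.factorial := by positivity
      rw [div_le_iff₀ hf] at h1
      calc ((i:ℝ)+1)^s = (2/y)^s * (y/2*(i+1))^s := by
            rw [← mul_pow]; congr 1; field_simp
        _ ≤ (2/y)^s * (Real.exp (y/2*(i+1)) * s.factorial) := by gcongr
        _ = _ := by ring
    rw [h2, ← mul_assoc]
    exact mul_le_mul_of_nonneg_right h3 (Real.exp_pos _).le
  refine (Finset.sum_le_sum fun i _ => h i).trans ?_
  rw [← Finset.mul_sum]
  refine (mul_le_mul_of_nonneg_left (geom_exp_le (y/2) (by positivity) N) (by positivity)).trans (le_of_eq ?_)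
  rw [div_pow, pow_succ, pow_succ]; field_simp

theorem mom_swap (x : ℝ) (hx : 0 < x) (N r : ℕ) :
    Mom x N r = ∑' k : ℕ, ∑ i ∈ Finset.range N, ((i:ℝ)+1)^(r+1) * (((k:ℝ) + 1) ^ r * wt x i k) := by
  rw [Mom, Summable.tsum_finsetSum]
  exact fun i _ => (summable_poly_wt x hx i r).mul_left _

theorem mom_le (x : ℝ) (hx : 0 < x) (N r : ℕ) :
    Mom x N r ≤ (r+1).factorial * 2 ^ (r+2) / x ^ (r+2) * (π^2/6) := by
  rw [mom_swap x hx]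
  refine tsum_le_of_sum_le' (by positivity) fun s => ?_
  refine le_trans ?_ (mul_le_mul_of_nonneg_left
    (zeta2_shift.tsum_eq ▸ zeta2_shift.summable.sum_le_tsum s (fun i _ => by positivity)) (by positivity))
  rw [Finset.mul_sum]
  refine Finset.sum_le_sum fun k _ => ?_
  have := pow_exp_le (r+1) (x * (k+1)) (by positivity) N
  calc ∑ i ∈ Finset.range N, ((i:ℝ)+1)^(r+1) * (((k:ℝ) + 1) ^ r * wt x i k)
      = ((k:ℝ) + 1) ^ r * ∑ i ∈ Finset.range N, ((i:ℝ)+1)^(r+1) * Real.exp (-(x * (k+1) * (i+1))) := by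
        rw [Finset.mul_sum]
        refine Finset.sum_congr rfl fun i _ => ?_
        rw [wt, show x * ((i+1) * ((k:ℝ)+1)) = x * (k+1) * (i+1) by ring]; ring
    _ ≤ ((k:ℝ) + 1) ^ r * ((r+1).factorial * 2 ^ (r+1+1) / (x * (k+1)) ^ (r+1+1)) := by gcongr
    _ = _ := by
        rw [mul_pow]; field_simp; ring

theorem hasSum_lin (y : ℝ) (hy : 0 < y) :
    HasSum (fun i : ℕ => ((i:ℝ)+1) * Real.exp (-(y * (i+1)))) (1 / (2 * Real.sinh (y/2))^2) := by
  have h1 : Real.exp (-y) < 1 := by rw [Real.exp_lt_one_iff]; linarith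
  have hs := hasSum_coe_mul_geometric_of_norm_lt_one (r := Real.exp (-y))
    (by rwa [Real.norm_of_nonneg (Real.exp_nonneg _)])
  have := (hasSum_nat_add_iff (f := fun n : ℕ => (n:ℝ) * Real.exp (-y)^n) 1
    (g := Real.exp (-y) / (1 - Real.exp (-y))^2)).mpr (by simpa using hs)
  have e : Real.exp (-y) / (1 - Real.exp (-y))^2 = 1 / (2 * Real.sinh (y/2))^2 := by
    rw [Real.sinh_eq]
    have e1 : Real.exp (-y) = Real.exp (-(y/2))^2 := by rw [← Real.exp_nat_mul]; congr 1; push_cast; ring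
    have e2 : Real.exp (y/2) = (Real.exp (-(y/2)))⁻¹ := by rw [← Real.exp_neg]; simp
    rw [e1, e2]
    rw [e1] at h1
    have h0 := Real.exp_pos (-(y/2))
    set a := Real.exp (-(y/2))
    have : a⁻¹ - a = (1 - a^2)/a := by field_simp
    have h2 : 1 - a^2 ≠ 0 := by linarith
    rw [this]
    field_simp
  rw [e] at this
  refine this.congr_fun fun i => ?_
  rw [← Real.exp_nat_mul]; push_cast; congr 2; ring

theorem sinh_low (y : ℝ) (hy : 0 < y) : 1 / (2 * Real.sinh (y/2))^2 ≤ 1 / y^2 := by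
  have : y/2 ≤ Real.sinh (y/2) := Real.self_le_sinh_iff.mpr (by linarith)
  gcongr; linarith

theorem sinh_up (y : ℝ) (hy : 0 < y) : 1 / y^2 - 1 ≤ 1 / (2 * Real.sinh (y/2))^2 := by
  by_cases h : y ≤ 1
  · have a1 := Real.exp_bound (x := y) (by rw [abs_of_pos hy]; exact h) (n := 4) (by norm_num)
    have a2 := Real.exp_bound (x := -y) (by rw [abs_neg, abs_of_pos hy]; exact h) (n := 4) (by norm_num)
    rw [abs_neg] at a2
    rw [abs_of_pos hy] at a1 a2
    have b1 := (abs_le.mp a1).2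
    have b2 := (abs_le.mp a2).2
    norm_num [Finset.sum_range_succ, Nat.factorial] at b1 b2
    have e : (2 * Real.sinh (y/2))^2 = Real.exp y + Real.exp (-y) - 2 := by
      rw [Real.sinh_eq]
      have e1 : Real.exp (-y) = Real.exp (-(y/2))^2 := by rw [← Real.exp_nat_mul]; congr 1; push_cast; ring
      have e3 : Real.exp y = Real.exp ((y/2))^2 := by rw [← Real.exp_nat_mul]; congr 1; push_cast; ring
      have e2 : Real.exp (y/2) * Real.exp (-(y/2)) = 1 := by rw [← Real.exp_add]; simp
      rw [e1, e3]; linear_combination (-2) * e2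
    have pos : 0 < (2 * Real.sinh (y/2))^2 := by
      have := Real.sinh_pos_iff.mpr (by linarith : 0 < y/2)
      positivity
    have up : (2 * Real.sinh (y/2))^2 ≤ y^2 + y^4 := by rw [e]; nlinarith [pow_pos hy 4]
    refine le_trans ?_ (one_div_le_one_div_of_le pos up)
    rw [div_sub' (by positivity), div_le_div_iff₀ (by positivity) (by positivity)]
    nlinarith [pow_pos hy 4, pow_pos hy 6]
  · push Not at h
    have : 1 / y^2 ≤ 1 := by
      rw [div_le_one (by positivity)]; nlinarith
    have : 0 ≤ 1 / (2 * Real.sinh (y/2))^2 := by positivity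
    linarith

theorem mom0_le (x : ℝ) (hx : 0 < x) (N : ℕ) : Mom x N 0 ≤ π^2/6 / x^2 := by
  rw [mom_swap x hx, div_eq_mul_one_div, mul_comm]
  refine tsum_le_of_sum_le' (by positivity) fun s => ?_
  refine le_trans ?_ (mul_le_mul_of_nonneg_left
    (zeta2_shift.tsum_eq ▸ zeta2_shift.summable.sum_le_tsum s (fun i _ => by positivity)) (by positivity))
  rw [Finset.mul_sum]
  refine Finset.sum_le_sum fun k _ => ?_
  have h := hasSum_lin (x * (k+1)) (by positivity)
  have h1 := h.summable.sum_le_tsum (Finset.range N) (fun i _ => by positivity)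
  rw [h.tsum_eq] at h1
  refine le_trans (le_of_eq ?_) (h1.trans ((sinh_low _ (by positivity)).trans (le_of_eq ?_)))
  · refine Finset.sum_congr rfl fun i _ => ?_
    rw [wt, show x * ((i+1) * ((k:ℝ)+1)) = x * (k+1) * (i+1) by ring]; ring
  · rw [mul_pow]; field_simp

theorem mom0_ge (x : ℝ) (hx : 0 < x) (hx1 : x ≤ 1) :
    ∀ᶠ N in Filter.atTop, π^2/6 / x^2 - 4 / x ≤ Mom x N 0 := by
  set K := ⌈1/x⌉₊ with hK
  have hK1 : 1/x ≤ K := Nat.le_ceil _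
  have hK2 : (K:ℝ) < 1/x + 1 := Nat.ceil_lt_add_one (by positivity)
  have lim : Filter.Tendsto (fun N => ∑ k ∈ Finset.range (K+1), ∑ i ∈ Finset.range N, ((i:ℝ)+1) * Real.exp (-(x * (k+1) * (i+1))))
      Filter.atTop (nhds (∑ k ∈ Finset.range (K+1), 1 / (2 * Real.sinh (x * (k+1)/2))^2)) := by
    refine tendsto_finsetSum _ fun k _ => ?_
    exact (hasSum_lin (x * (k+1)) (by positivity)).tendsto_sum_nat
  have L : π^2/6 / x^2 - 4 / x < ∑ k ∈ Finset.range (K+1), 1 / (2 * Real.sinh (x * (k+1)/2))^2 := by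
    have h1 : ∑ k ∈ Finset.range (K+1), (1/x^2 * (1 / ((k:ℝ)+1)^2) - 1) ≤
        ∑ k ∈ Finset.range (K+1), 1 / (2 * Real.sinh (x * (k+1)/2))^2 := by
      refine Finset.sum_le_sum fun k _ => le_trans (le_of_eq ?_) (sinh_up (x*(k+1)) (by positivity))
      rw [mul_pow]; field_simp
    rw [Finset.sum_sub_distrib, ← Finset.mul_sum] at h1
    have h2 := mul_le_mul_of_nonneg_left (zeta2_tail K) (by positivity : 0 ≤ 1/x^2)
    have h3 : 1 / ((K:ℝ)+1) < x := by
      rw [div_lt_iff₀ (by positivity)]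
      have := mul_le_mul_of_nonneg_left hK1 hx.le
      rw [mul_one_div_cancel hx.ne'] at this
      linarith
    have h4 : 1/x^2 * (1 / ((K:ℝ)+1)) < 1/x := by
      calc 1/x^2 * (1 / ((K:ℝ)+1)) < 1/x^2 * x := by gcongr
        _ = 1/x := by field_simp
    have h5 : 1 ≤ 1/x := by rw [le_div_iff₀ hx]; linarith
    have h6 : 4/x = 4 * (1/x) := by ring
    have h7 : π^2/6/x^2 = 1/x^2 * (π^2/6) := by ring
    simp at h1
    simp at *
    nlinarith
  filter_upwards [lim.eventually (lt_mem_nhds L)] with N hN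
  refine hN.le.trans ?_
  rw [mom_swap x hx]
  have hsum : Summable (fun k : ℕ => ∑ i ∈ Finset.range N, ((i:ℝ)+1)^(0+1) * (((k:ℝ) + 1) ^ 0 * wt x i k)) :=
    summable_sum fun i _ => (summable_poly_wt x hx i 0).mul_left _
  refine le_trans (le_of_eq ?_) (hsum.sum_le_tsum (Finset.range (K+1)) (fun k _ => ?_))
  · refine Finset.sum_congr rfl fun k _ => Finset.sum_congr rfl fun i _ => ?_
    rw [wt, show x * ((i+1) * ((k:ℝ)+1)) = x * (k+1) * (i+1) by ring]; ring
  · exact Finset.sum_nonneg fun i _ => by have := wt_pos x i k; positivity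

end MOM


section ARC

theorem cos_sum_eq (x : ℝ) (hx : 0 < x) (N : ℕ) (θ : ℝ) :
    ∑ i ∈ Finset.range N, Real.exp (-(x * (i+1))) * (1 - Real.cos (θ * (i+1))) ≥
      (1 / (1 - Real.exp (-x)) - ((1 - Complex.exp (-x + θ * Complex.I))⁻¹).re)
        - 2 * (Real.exp (-x) ^ (N+1) / (1 - Real.exp (-x))) := by
  set z := Complex.exp (-x + θ * Complex.I) with hz
  set q := Real.exp (-x) with hq
  have hq0 : 0 < q := Real.exp_pos _
  have hq1 : q < 1 := by rw [hq, Real.exp_lt_one_iff]; linarith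
  have hzn : ‖z‖ = q := by rw [hz, Complex.norm_exp]; simp [hq]
  have hz1 : z ≠ 1 := by intro h; rw [h] at hzn; simp at hzn; linarith
  have hzd : 1 - z ≠ 0 := sub_ne_zero.mpr hz1.symm
  have e1 : ∀ i : ℕ, Real.exp (-(x * (i+1))) * (1 - Real.cos (θ * (i+1))) = q^(i+1) - (z^(i+1)).re := by
    intro i
    have : z^(i+1) = ((q^(i+1) : ℝ) : ℂ) * Complex.exp (((θ * (i+1) : ℝ) : ℂ) * Complex.I) := by
      rw [hz, hq, ← Complex.exp_nat_mul, ← Real.exp_nat_mul, Complex.ofReal_exp, ← Complex.exp_add]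
      congr 1; push_cast; ring
    rw [this, Complex.re_ofReal_mul, Complex.exp_ofReal_mul_I_re]
    have : Real.exp (-(x * (i+1))) = q^(i+1) := by rw [hq, ← Real.exp_nat_mul]; congr 1; push_cast; ring
    rw [this]; ring
  simp_rw [e1]
  rw [Finset.sum_sub_distrib, ← Complex.re_sum]
  have s1 : ∑ i ∈ Finset.range N, q^(i+1) = 1/(1-q) - 1 - q^(N+1)/(1-q) := by
    simp_rw [pow_succ]
    rw [← Finset.sum_mul, geom_sum_eq hq1.ne]
    have : 1 - q ≠ 0 := by linarith
    have : q - 1 ≠ 0 := by linarith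
    have h3 : q - 1 = -(1-q) := by ring
    rw [h3]
    field_simp; ring
  have s2 : ∑ i ∈ Finset.range N, z^(i+1) = (1 - z)⁻¹ - 1 - z^(N+1) * (1-z)⁻¹ := by
    simp_rw [pow_succ]
    rw [← Finset.sum_mul, geom_sum_eq hz1]
    have h3 : z - 1 = -(1-z) := by ring
    rw [h3]
    field_simp; ring
  rw [s1, s2]
  have b : |(z^(N+1) * (1-z)⁻¹).re| ≤ q^(N+1)/(1-q) := by
    refine (Complex.abs_re_le_norm _).trans ?_
    rw [norm_mul, norm_pow, hzn, norm_inv, div_eq_mul_inv]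
    have : 1 - q ≤ ‖1 - z‖ := by
      have := norm_sub_norm_le 1 z; rw [hzn] at this; simpa using this
    gcongr
  have b' := (abs_le.mp b).1
  simp only [Complex.sub_re, Complex.one_re]
  linarith

theorem re_inv_eq (x : ℝ) (hx : 0 < x) (θ : ℝ) :
    1 / (1 - Real.exp (-x)) - ((1 - Complex.exp (-x + θ * Complex.I))⁻¹).re =
      Real.exp (-x) * (1 + Real.exp (-x)) * (1 - Real.cos θ) /
        ((1 - Real.exp (-x)) * ((1 - Real.exp (-x))^2 + 2 * Real.exp (-x) * (1 - Real.cos θ))) := by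
  have hq1 : Real.exp (-x) < 1 := by rw [Real.exp_lt_one_iff]; linarith
  have hq0 := Real.exp_pos (-x)
  have hz : Complex.exp (-x + θ * Complex.I) = ((Real.exp (-x) : ℝ):ℂ) * Complex.exp ((θ:ℂ) * Complex.I) := by
    rw [Complex.ofReal_exp, ← Complex.exp_add]; push_cast; rfl
  set q := Real.exp (-x) with hq
  have re : (1 - Complex.exp (-x + θ * Complex.I)).re = 1 - q * Real.cos θ := by
    rw [hz, Complex.sub_re, Complex.re_ofReal_mul, Complex.exp_ofReal_mul_I_re]; simp
  have im : (1 - Complex.exp (-x + θ * Complex.I)).im = - (q * Real.sin θ) := by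
    rw [hz, Complex.sub_im, Complex.im_ofReal_mul, Complex.exp_ofReal_mul_I_im]; simp
  have nsq : Complex.normSq (1 - Complex.exp (-x + θ * Complex.I)) = (1-q)^2 + 2 * q * (1 - Real.cos θ) := by
    rw [Complex.normSq_apply, re, im]
    have := Real.sin_sq_add_cos_sq θ
    linear_combination q^2 * this
  rw [Complex.inv_re, nsq, re]
  have h1 : 0 < 1 - q := by linarith
  have h2 : 0 < (1-q)^2 + 2 * q * (1 - Real.cos θ) := by
    have := Real.cos_le_one θ
    have := mul_nonneg hq0.le (sub_nonneg.mpr this)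
    nlinarith [pow_pos h1 2]
  rw [div_sub_div _ _ h1.ne' h2.ne']
  congr 1
  ring

theorem re_low (x : ℝ) (hx : 0 < x) (hx1 : x ≤ 1) (θ : ℝ) (hθ : |θ| ≤ π) :
    1 / 15 * (θ^2 / (x * (x^2 + θ^2))) ≤
    1 / (1 - Real.exp (-x)) - ((1 - Complex.exp (-x + θ * Complex.I))⁻¹).re := by
  rw [re_inv_eq x hx]
  have hq1 : Real.exp (-x) < 1 := by rw [Real.exp_lt_one_iff]; linarith
  have hq3 : 1/3 ≤ Real.exp (-x) := by
    have h1 : Real.exp (-1) ≤ Real.exp (-x) := Real.exp_le_exp.mpr (by linarith)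
    have h2 : Real.exp 1 < 3 := by linarith [Real.exp_one_lt_d9]
    rw [Real.exp_neg] at h1
    have : (3:ℝ)⁻¹ ≤ (Real.exp 1)⁻¹ := by gcongr
    linarith
  have hqx : 1 - Real.exp (-x) ≤ x := by linarith [Real.add_one_le_exp (-x)]
  set q := Real.exp (-x)
  have c1 := Real.cos_le_one_sub_mul_cos_sq hθ
  have c2 := Real.one_sub_sq_div_two_le_cos (x := θ)
  set s := 1 - Real.cos θ with hs
  have s1 : 2/π^2 * θ^2 ≤ s := by rw [hs]; linarith
  have s2 : s ≤ θ^2/2 := by rw [hs]; linarith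
  have hpi : π^2 ≤ 10 := by nlinarith [Real.pi_lt_d2, Real.pi_pos]
  have s1' : 1/5 * θ^2 ≤ s := by
    refine le_trans ?_ s1
    have : 1/5 ≤ 2/π^2 := by rw [div_le_div_iff₀ (by norm_num) (by positivity)]; linarith
    gcongr
  have s0 : 0 ≤ s := by nlinarith [sq_nonneg θ]
  rw [← mul_div_assoc]
  have h1 : 0 < 1 - q := by linarith
  have q0 : 0 < q := by linarith
  have den : (1-q) * ((1-q)^2 + 2 * q * s) ≤ x * (x^2 + θ^2) := by
    have : (1-q)^2 ≤ x^2 := by gcongr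
    have : 2 * q * s ≤ θ^2 := by nlinarith
    have : 0 ≤ 2 * q * s := by positivity
    apply mul_le_mul hqx (by linarith) (by positivity) hx.le
  have num : 1/15 * θ^2 ≤ q * (1+q) * s := by
    have : 1/3 ≤ q * (1+q) := by nlinarith
    have := mul_le_mul this s1' (by positivity) (by nlinarith)
    linarith
  have dpos : 0 < (1-q) * ((1-q)^2 + 2 * q * s) := by positivity
  exact div_le_div₀ (by positivity) num dpos den

theorem arc_bound (x : ℝ) (hx : 0 < x) (hx1 : x ≤ 1) :
    ∀ᶠ N in Filter.atTop, ∀ θ : ℝ, |θ| ≤ π →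
      ‖Complex.exp (Psi x N θ)‖ ≤ Real.exp 1 * (Real.exp (-(θ^2/(30*x^3))) + Real.exp (-(1/(30*x)))) := by
  have hq1 : Real.exp (-x) < 1 := by rw [Real.exp_lt_one_iff]; linarith
  have lim : Filter.Tendsto (fun N : ℕ => 2 * (Real.exp (-x) ^ (N+1) / (1 - Real.exp (-x)))) Filter.atTop (nhds 0) := by
    have := ((tendsto_pow_atTop_nhds_zero_of_lt_one (Real.exp_pos _).le hq1).comp (Filter.tendsto_add_atTop_nat 1))
    have := (this.div_const (1 - Real.exp (-x))).const_mul 2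
    simpa using this
  filter_upwards [lim.eventually (gt_mem_nhds one_pos)] with N hN θ hθ
  rw [Complex.norm_exp]
  have h1 := psi_re x hx N θ
  have h2 := cos_sum_eq x hx N θ
  have h3 := re_low x hx hx1 θ hθ
  have h4 : (Psi x N θ).re ≤ 1 + -(1 / 15 * (θ^2 / (x * (x^2 + θ^2)))) := by linarith
  refine (Real.exp_le_exp.mpr h4).trans ?_
  rw [Real.exp_add]
  gcongr
  by_cases hc : |θ| ≤ x
  · have : θ^2 ≤ x^2 := by rw [← sq_abs θ]; gcongr
    have : Real.exp (-(1 / 15 * (θ^2 / (x * (x^2 + θ^2))))) ≤ Real.exp (-(θ^2/(30*x^3))) := by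
      rw [Real.exp_le_exp, neg_le_neg_iff, ← mul_div_assoc, div_le_div_iff₀ (by positivity) (by positivity)]
      have : 0 ≤ θ^2 * (x * (x^2 - θ^2)) := by
        apply mul_nonneg (sq_nonneg _) (mul_nonneg hx.le (by linarith))
      nlinarith
    linarith [Real.exp_pos (-(1/(30*x)))]
  · push Not at hc
    have : x^2 ≤ θ^2 := by rw [← sq_abs θ]; gcongr
    have : Real.exp (-(1 / 15 * (θ^2 / (x * (x^2 + θ^2))))) ≤ Real.exp (-(1/(30*x))) := by
      rw [Real.exp_le_exp, neg_le_neg_iff, ← mul_div_assoc, div_le_div_iff₀ (by positivity) (by positivity)]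
      nlinarith
    linarith [Real.exp_pos (-(θ^2/(30*x^3)))]

end ARC


section PartF
open MeasureTheory Filter

theorem psi_cont (x : ℝ) (hx : 0 < x) (N : ℕ) : Continuous (fun θ : ℝ => Complex.exp (Psi x N θ)) := by
  have hP : (∏ i ∈ Finset.range N, (1 - Real.exp (-(x * (i+1))))⁻¹ : ℝ) ≠ 0 := by
    refine Finset.prod_ne_zero_iff.mpr fun i _ => inv_ne_zero ?_
    have : Real.exp (-(x * (i + 1))) < 1 := by
      rw [Real.exp_lt_one_iff]; have : 0 < x * (i+1) := by positivity
      linarith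
    linarith
  have e : (fun θ : ℝ => Complex.exp (Psi x N θ)) = fun θ : ℝ =>
      ((∏ i ∈ Finset.range N, (1 - Real.exp (-(x * (i+1))))⁻¹ : ℝ) : ℂ)⁻¹ *
      ∏ i ∈ Finset.range N, (1 - Complex.exp (-x + θ * Complex.I) ^ (i+1))⁻¹ := by
    funext θ
    rw [psi_prod x hx, inv_mul_cancel_left₀]
    exact_mod_cast hP
  rw [e]
  refine continuous_const.mul (continuous_finsetProd _ fun i _ => Continuous.inv₀ (by fun_prop) ?_)
  intro θ h
  rw [sub_eq_zero] at h
  have hz : ‖Complex.exp (-x + θ * Complex.I) ^ (i+1)‖ < 1 := by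
    rw [norm_pow, Complex.norm_exp]
    refine pow_lt_one₀ (Real.exp_nonneg _) ?_ (by omega)
    simp [hx]
  rw [← h] at hz
  simp at hz

theorem mom_nonneg (x : ℝ) (N r : ℕ) : 0 ≤ Mom x N r := by
  refine Finset.sum_nonneg fun i _ => tsum_nonneg fun k => ?_
  have := wt_pos x i k
  positivity

theorem gauss_pi (b : ℝ) (hb : 0 < b) : ∫ θ in (-π)..π, Real.exp (-b * θ^2) ≤ √(π / b) := by
  rw [← integral_gaussian, intervalIntegral.integral_of_le (by linarith [pi_pos])]
  exact setIntegral_le_integral (integrable_exp_neg_mul_sq hb) (ae_of_all _ fun _ => (Real.exp_pos _).le)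

theorem exp_neg_inv_le (x : ℝ) (hx : 0 < x) : Real.exp (-(1/(30*x))) ≤ 1800 * x^2 := by
  have h := Real.quadratic_le_exp_of_nonneg (x := 1/(30*x)) (by positivity)
  rw [Real.exp_neg, inv_le_comm₀ (Real.exp_pos _) (by positivity)]
  refine le_trans ?_ h
  have e : (1800 * x^2)⁻¹ = (1/(30*x))^2/2 := by field_simp; norm_num
  rw [e]
  have : 0 < 1/(30*x) := by positivity
  linarith

/-- integral of the major error function -/
theorem err_int (b c : ℝ) (hb : 0 < b) (c0 : ℝ) (hc : 0 ≤ c0) : ∫ θ in (-π)..π, Real.exp 1 * (c0 * Real.exp (-b * θ^2) + c) ≤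
    Real.exp 1 * (c0 * √(π/b) + 2 * π * c) := by
  rw [intervalIntegral.integral_const_mul, intervalIntegral.integral_add
    (Continuous.intervalIntegrable (by fun_prop) _ _) (Continuous.intervalIntegrable (by fun_prop) _ _),
    intervalIntegral.integral_const_mul, intervalIntegral.integral_const]
  have := gauss_pi b hb
  have e : (π - -π) • c = 2 * π * c := by rw [smul_eq_mul]; ring
  rw [e]
  gcongr

theorem up_int (r : ℝ) (hr : 0 < r) (hr1 : r ≤ 1) : ∀ᶠ N in atTop,
    ∫ θ in (-π)..π, ‖Complex.exp (Psi (r^2) N θ)‖ ≤ Real.exp 1 * (√(30*π) + 3600*π) * r^3 := by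
  filter_upwards [arc_bound (r^2) (by positivity) (pow_le_one₀ hr.le hr1)] with N hN
  have h1 : ∫ θ in (-π)..π, ‖Complex.exp (Psi (r^2) N θ)‖ ≤ ∫ θ in (-π)..π,
      Real.exp 1 * (1 * Real.exp (-(1/(30*r^6)) * θ^2) + Real.exp (-(1/(30*r^2)))) := by
    refine intervalIntegral.integral_mono_on (by linarith [pi_pos])
      (Continuous.intervalIntegrable (psi_cont _ (by positivity) N).norm _ _)
      (Continuous.intervalIntegrable (by fun_prop) _ _) fun θ hθ => ?_
    refine (hN θ (abs_le.mpr hθ)).trans (le_of_eq ?_)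
    rw [one_mul]
    congr 4
    ring
  refine h1.trans ((err_int _ _ (by positivity) _ zero_le_one).trans ?_)
  have e : √(π / (1 / (30*r^6))) = √(30*π) * r^3 := by
    rw [show π / (1 / (30*r^6)) = (30*π) * (r^3)^2 by field_simp]
    rw [Real.sqrt_mul (by positivity), Real.sqrt_sq (by positivity)]
  rw [e, one_mul]
  have h2 := exp_neg_inv_le (r^2) (by positivity)
  have h3 : (r^2)^2 ≤ r^3 := by
    rw [← pow_mul]; exact pow_le_pow_of_le_one hr.le hr1 (by norm_num)
  have h4 : Real.exp (-(1/(30*r^2))) ≤ 1800 * r^3 := by linarith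
  have h5 : 2 * π * Real.exp (-(1/(30*r^2))) ≤ 2 * π * (1800 * r^3) := by gcongr
  rw [mul_assoc (Real.exp 1)]
  refine mul_le_mul_of_nonneg_left ?_ (Real.exp_nonneg _)
  linarith

theorem low_pt (r L : ℝ) (hr : 0 < r) (hL : 1 ≤ L) (hsm : (4*L + 640*L^3) * r ≤ 1/4) (n : ℝ)
    (hn : n = π^2/6/(r^2)^2) (N : ℕ) (hN0 : π^2/6/(r^2)^2 - 4/(r^2) ≤ Mom (r^2) N 0) (θ : ℝ)
    (hθ : |θ| ≤ L * r^3) :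
    1/2 * Real.exp (-(θ^2/2 * (27/(r^2)^3))) ≤
      (Complex.exp (Psi (r^2) N θ) * Complex.exp (-(n * (θ * Complex.I)))).re := by
  have hx : 0 < r^2 := by positivity
  have hpi : π^2/6 ≤ 10/6 := by have := Real.pi_lt_d2; have := pi_pos; nlinarith
  have hm1 : Mom (r^2) N 1 ≤ 27/(r^2)^3 := by
    refine (mom_le _ hx N 1).trans ?_
    norm_num [Nat.factorial]
    rw [div_mul_eq_mul_div]
    gcongr
    linarith
  have hm2 : Mom (r^2) N 2 ≤ 160/(r^2)^4 := by
    refine (mom_le _ hx N 2).trans ?_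
    norm_num [Nat.factorial]
    rw [div_mul_eq_mul_div]
    gcongr
    linarith
  have hm0 : |Mom (r^2) N 0 - n| ≤ 4/r^2 := by
    have := mom0_le _ hx N
    rw [abs_le]; constructor
    · rw [hn]; linarith
    · have : 0 < 4/r^2 := by positivity
      rw [hn]; linarith
  set δ : ℂ := (Psi (r^2) N θ - Complex.I * ((θ * Mom (r^2) N 0 : ℝ) : ℂ) + ((θ^2/2 * Mom (r^2) N 1 : ℝ) : ℂ)) +
    Complex.I * ((θ * (Mom (r^2) N 0 - n) : ℝ) : ℂ) with hδ
  have e : Complex.exp (Psi (r^2) N θ) * Complex.exp (-(n * (θ * Complex.I))) =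
      ((Real.exp (-(θ^2/2 * Mom (r^2) N 1)) : ℝ) : ℂ) * Complex.exp δ := by
    rw [Complex.ofReal_exp, ← Complex.exp_add, ← Complex.exp_add]
    congr 1
    rw [hδ]; push_cast; ring
  have hd : ‖δ‖ ≤ 1/4 := by
    refine (norm_add_le _ _).trans ?_
    refine (add_le_add (psi_taylor _ hx N θ) (le_refl _)).trans ?_
    rw [norm_mul, Complex.norm_I, one_mul, Complex.norm_real, Real.norm_eq_abs, abs_mul]
    calc 4 * |θ|^3 * Mom (r^2) N 2 + |θ| * |Mom (r^2) N 0 - n|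
        ≤ 4 * (L*r^3)^3 * (160/(r^2)^4) + (L * r^3) * (4/r^2) := by
          have := mom_nonneg (r^2) N 2
          gcongr
      _ = (4*L + 640*L^3) * r := by field_simp; ring
      _ ≤ _ := hsm
  rw [e, Complex.re_ofReal_mul]
  have h1 := Complex.norm_exp_sub_one_le (x := δ) (by linarith)
  have h2 : 1 - (Complex.exp δ).re ≤ ‖Complex.exp δ - 1‖ := by
    have := Complex.abs_re_le_norm (Complex.exp δ - 1)
    have := neg_abs_le (Complex.exp δ - 1).re
    simp only [Complex.sub_re, Complex.one_re] at *
    linarith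
  have h3 : 1/2 ≤ (Complex.exp δ).re := by linarith
  rw [mul_comm]
  gcongr

theorem low_int (L κ : ℝ) (hL : 1 ≤ L) (hκ : κ = 1/2 * Real.exp (-(27/2)))
    (hL2 : Real.exp 1 * (Real.exp (-(L^2/60)) * √(60*π)) ≤ κ/2)
    (r : ℝ) (hr : 0 < r) (hr1 : r ≤ 1) (hsm : (4*L + 640*L^3) * r ≤ 1/4)
    (hsm2 : Real.exp 1 * (3600 * π) * r ≤ κ/2) (n : ℝ) (hn : n = π^2/6/(r^2)^2) :
    ∀ᶠ N in atTop, κ * r^3 ≤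
      ∫ θ in (-π)..π, (Complex.exp (Psi (r^2) N θ) * Complex.exp (-(n * (θ * Complex.I)))).re := by
  filter_upwards [arc_bound (r^2) (by positivity) (pow_le_one₀ hr.le hr1),
    mom0_ge (r^2) (by positivity) (pow_le_one₀ hr.le hr1)] with N hN hN0
  set F : ℝ → ℝ := fun θ => (Complex.exp (Psi (r^2) N θ) * Complex.exp (-(n * (θ * Complex.I)))).re with hF
  set E : ℝ → ℝ := fun θ => Real.exp 1 * (Real.exp (-(L^2/60)) * Real.exp (-(1/(60*r^6)) * θ^2) + Real.exp (-(1/(30*r^2)))) with hE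
  have cF : Continuous F := Complex.continuous_re.comp ((psi_cont _ (by positivity) N).mul (by fun_prop))
  have cE : Continuous E := by rw [hE]; fun_prop
  have E0 : ∀ θ, 0 ≤ E θ := fun θ => by rw [hE]; positivity
  have hκ0 : 0 < κ := by rw [hκ]; positivity
  have p1 : ∀ θ, |θ| ≤ π → 0 ≤ F θ + E θ := by
    intro θ hθ
    by_cases h : |θ| ≤ L * r^3
    · have := low_pt r L hr hL hsm n hn N hN0 θ h
      have h2 : 0 ≤ 1/2 * Real.exp (-(θ^2/2 * (27/(r^2)^3))) := by positivity
      have := E0 θ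
      simp only [hF]
      linarith
    · push Not at h
      have h1 : -F θ ≤ ‖Complex.exp (Psi (r^2) N θ)‖ := by
        have := Complex.abs_re_le_norm (Complex.exp (Psi (r^2) N θ) * Complex.exp (-(n * (θ * Complex.I))))
        rw [norm_mul, Complex.norm_exp (-_)] at this
        simp only [Complex.neg_re, Complex.mul_re, Complex.ofReal_re, Complex.ofReal_im, Complex.I_re, Complex.I_im, Complex.mul_im] at this
        simp at this
        have h3 := neg_abs_le (F θ)
        simp only [hF] at *
        simp only [Complex.mul_re] at *
        linarith
      have h2 := hN θ hθ
      have h3 : Real.exp (-(θ^2/(30*(r^2)^3))) ≤ Real.exp (-(L^2/60)) * Real.exp (-(1/(60*r^6)) * θ^2) := by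
        rw [← Real.exp_add]
        apply Real.exp_le_exp.mpr
        have h4 : (L*r^3)^2 ≤ θ^2 := by
          rw [← sq_abs θ]; gcongr
        have h5 : L^2/60 ≤ θ^2/(60*r^6) := by
          rw [div_le_div_iff₀ (by norm_num) (by positivity)]
          nlinarith
        have h6 : θ^2/(30*(r^2)^3) = θ^2/(60*r^6) + θ^2/(60*r^6) := by field_simp; ring
        have h7 : (-(1/(60*r^6)) * θ^2) = - (θ^2/(60*r^6)) := by ring
        rw [h6, h7]; linarith
      have h4 : Real.exp 1 * (Real.exp (-(θ^2/(30*(r^2)^3))) + Real.exp (-(1/(30*r^2)))) ≤ E θ := by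
        simp only [hE]; gcongr
      linarith
  have p2 : ∀ θ, |θ| ≤ r^3 → κ ≤ F θ + E θ := by
    intro θ hθ
    have := low_pt r L hr hL hsm n hn N hN0 θ (hθ.trans (le_mul_of_one_le_left (by positivity) hL))
    have h2 : κ ≤ 1/2 * Real.exp (-(θ^2/2 * (27/(r^2)^3))) := by
      rw [hκ]
      gcongr 1/2 * Real.exp ?_
      have : θ^2 ≤ (r^3)^2 := by rw [← sq_abs θ]; gcongr
      have : θ^2/2 * (27/(r^2)^3) ≤ (r^3)^2/2 * (27/(r^2)^3) := by gcongr
      have e : (r^3)^2/2 * (27/(r^2)^3) = 27/2 := by field_simp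
      linarith
    have := E0 θ
    simp only [hF]
    linarith
  have hs : r^3 ≤ π := (pow_le_one₀ hr.le hr1).trans (by linarith [Real.pi_gt_three])
  have i1 : ∫ θ in (-r^3)..(r^3), (F θ + E θ) ≤ ∫ θ in (-π)..π, (F θ + E θ) := by
    refine intervalIntegral.integral_mono_interval (by linarith) (by have : 0 < r^3 := by positivity
                                                                     linarith) hs ?_
      (Continuous.intervalIntegrable (cF.add cE) _ _)
    refine (ae_restrict_iff' measurableSet_Ioc).mpr (ae_of_all _ fun θ hθ => ?_)
    exact p1 θ (abs_le.mpr ⟨hθ.1.le, hθ.2⟩)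
  have i2 : ∫ θ in (-r^3)..(r^3), κ ≤ ∫ θ in (-r^3)..(r^3), (F θ + E θ) := by
    refine intervalIntegral.integral_mono_on (by have : 0 < r^3 := by positivity
                                                 linarith) (Continuous.intervalIntegrable (by fun_prop) _ _)
      (Continuous.intervalIntegrable (cF.add cE) _ _) fun θ hθ => p2 θ (abs_le.mpr hθ)
  rw [intervalIntegral.integral_const, smul_eq_mul] at i2
  have i0 := intervalIntegral.integral_add (μ := volume) (a := -π) (b := π) (Continuous.intervalIntegrable cF _ _) (Continuous.intervalIntegrable cE _ _)
  rw [i0] at i1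
  have i3 := err_int (1/(60*r^6)) (Real.exp (-(1/(30*r^2)))) (by positivity) (Real.exp (-(L^2/60))) (Real.exp_nonneg _)
  have e : √(π / (1 / (60*r^6))) = √(60*π) * r^3 := by
    rw [show π / (1 / (60*r^6)) = (60*π) * (r^3)^2 by field_simp]
    rw [Real.sqrt_mul (by positivity), Real.sqrt_sq (by positivity)]
  rw [e] at i3
  have h2 := exp_neg_inv_le (r^2) (by positivity)
  have h5 : Real.exp 1 * (2 * π * Real.exp (-(1/(30*r^2)))) ≤ Real.exp 1 * (2 * π * (1800 * (r^2)^2)) := by gcongr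
  have h6 : Real.exp 1 * (2 * π * (1800 * (r^2)^2)) ≤ κ/2 * r^3 := by
    calc _ = Real.exp 1 * (3600 * π) * r * r^3 := by ring
      _ ≤ _ := by gcongr
  have h7 : Real.exp 1 * (Real.exp (-(L^2/60)) * √(60*π)) * r^3 ≤ κ/2 * r^3 := by gcongr
  have h8 : ∫ θ in (-π)..π, E θ ≤ κ * r^3 := by
    refine i3.trans ?_
    linarith
  linarith

theorem exists_LR : ∃ κ : ℝ, 0 < κ ∧ ∃ r0 : ℝ, 0 < r0 ∧ ∀ r, 0 < r → r ≤ r0 → r ≤ 1 ∧ ∀ n : ℝ, n = π^2/6/(r^2)^2 →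
    ∀ᶠ N in atTop, κ * r^3 ≤
      ∫ θ in (-π)..π, (Complex.exp (Psi (r^2) N θ) * Complex.exp (-(n * (θ * Complex.I)))).re := by
  set κ : ℝ := 1/2 * Real.exp (-(27/2)) with hκ
  have hκ0 : 0 < κ := by positivity
  obtain ⟨L, hL, hL2⟩ : ∃ L : ℝ, 1 ≤ L ∧ Real.exp 1 * (Real.exp (-(L^2/60)) * √(60*π)) ≤ κ/2 := by
    have : Tendsto (fun L : ℝ => Real.exp 1 * (Real.exp (-(L^2/60)) * √(60*π))) atTop (nhds (Real.exp 1 * (0 * √(60*π)))) := by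
      refine Tendsto.const_mul _ (Tendsto.mul_const _ ?_)
      refine Real.tendsto_exp_neg_atTop_nhds_zero.comp ?_
      exact (tendsto_pow_atTop (by norm_num)).atTop_div_const (by norm_num)
    simp only [zero_mul, mul_zero] at this
    have h := (this.eventually_le_const (half_pos hκ0)).and (eventually_ge_atTop 1)
    obtain ⟨L, h1, h2⟩ := h.exists
    exact ⟨L, h2, h1⟩
  refine ⟨κ, hκ0, min 1 (min (1/4/(4*L + 640*L^3)) (κ/2/(Real.exp 1 * (3600 * π)))), ?_, ?_⟩
  · have := pi_pos
    refine lt_min one_pos (lt_min ?_ ?_) <;> positivity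
  · intro r hr hr0
    have a1 := hr0.trans (min_le_left _ _)
    have a2 := (hr0.trans (min_le_right _ _)).trans (min_le_left _ _)
    have a3 := (hr0.trans (min_le_right _ _)).trans (min_le_right _ _)
    rw [le_div_iff₀ (by positivity)] at a2 a3
    refine ⟨a1, fun n hn => low_int L κ hL hκ hL2 r hr a1 (by linarith) (by linarith) n hn⟩

theorem ratio_bound : ∃ C : ℝ, 0 < C ∧ ∃ r0 : ℝ, 0 < r0 ∧ ∀ r, 0 < r → r ≤ r0 → ∀ n : ℕ, (n:ℝ) = π^2/6/(r^2)^2 →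
    ∀ j ≤ n, (Nat.card (Nat.Partition j) : ℝ) * Real.exp (-(r^2 * j)) ≤
      C * ((Nat.card (Nat.Partition n) : ℝ) * Real.exp (-(r^2 * n))) := by
  obtain ⟨κ, hκ, r0, hr0, H⟩ := exists_LR
  set K := Real.exp 1 * (√(30*π) + 3600*π) with hK
  have hK0 : 0 < K := by have := pi_pos; positivity
  refine ⟨K/κ, by positivity, r0, hr0, fun r hr hrr n hn j hj => ?_⟩
  obtain ⟨hr1, H⟩ := H r hr hrr
  obtain ⟨N, h1, h2, hNn⟩ := ((H n hn).and ((up_int r hr hr1).and (eventually_ge_atTop n))).exists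
  obtain ⟨a, ha0, haN, haS⟩ := gf_main N
  have hx : 0 < r^2 := by positivity
  set P : ℝ := ∏ i ∈ Finset.range N, (1 - Real.exp (-(r^2 * (i+1))))⁻¹ with hP
  have hP0 : 0 < P := by
    refine Finset.prod_pos fun i _ => inv_pos.mpr ?_
    have : Real.exp (-(r^2 * (i + 1))) < 1 := by
      rw [Real.exp_lt_one_iff]; have : 0 < r^2 * (i+1) := by positivity
      linarith
    linarith
  have key : ∀ m : ℕ, 2 * π * a m * Real.exp (-(r^2 * m)) =
      P * ∫ θ in (-π)..π, (Complex.exp (Psi (r^2) N θ) * Complex.exp (-((m:ℂ) * (θ * Complex.I)))).re := by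
    intro m
    have h := fo_coeff a _ haS (r^2) hx m
    have c : IntervalIntegrable (fun θ : ℝ => (P:ℂ) * (Complex.exp (Psi (r^2) N θ) * Complex.exp (-((m:ℂ) * (θ * Complex.I))))) volume (-π) π :=
      Continuous.intervalIntegrable (continuous_const.mul ((psi_cont _ hx N).mul (by fun_prop))) _ _
    have e : ∀ θ : ℝ, (∏ i ∈ Finset.range N, (1 - Complex.exp (-((r^2:ℝ):ℂ) + θ * Complex.I) ^ (i+1))⁻¹) * Complex.exp (-((m:ℂ) * (θ * Complex.I))) =
      (P:ℂ) * (Complex.exp (Psi (r^2) N θ) * Complex.exp (-((m:ℂ) * (θ * Complex.I)))) := by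
      intro θ; rw [psi_prod _ hx, mul_assoc]
    simp_rw [e] at h
    have h' := congrArg Complex.re h
    have h3 := intervalIntegral.intervalIntegral_re (𝕜 := ℂ) c
    simp only [RCLike.re_eq_complex_re] at h3
    rw [← h3] at h'
    simp_rw [Complex.re_ofReal_mul] at h'
    rw [intervalIntegral.integral_const_mul] at h'
    rw [h', ← Complex.ofReal_re (2 * π * a m * Real.exp (-(r^2 * m)))]
    push_cast; rfl
  have kn := key n
  have kj := key j
  have uj : ∫ θ in (-π)..π, (Complex.exp (Psi (r^2) N θ) * Complex.exp (-((j:ℂ) * (θ * Complex.I)))).re ≤ K * r^3 := by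
    refine le_trans (intervalIntegral.integral_mono_on (by linarith [pi_pos]) 
      (Continuous.intervalIntegrable (Complex.continuous_re.comp ((psi_cont _ hx N).mul (by fun_prop))) _ _)
      (Continuous.intervalIntegrable (psi_cont _ hx N).norm _ _) fun θ _ => ?_) h2
    refine (Complex.re_le_norm _).trans ?_
    rw [norm_mul, Complex.norm_exp (-_)]
    simp
  rw [← haN j (hj.trans hNn), ← haN n hNn]
  simp only [Complex.ofReal_natCast] at h1
  have lo : P * (κ * r^3) ≤ 2 * π * a n * Real.exp (-(r^2 * n)) := by
    rw [kn]; gcongr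
  have up : 2 * π * a j * Real.exp (-(r^2 * j)) ≤ P * (K * r^3) := by
    rw [kj]; gcongr
  have f : 2 * π * a j * Real.exp (-(r^2 * j)) ≤ K/κ * (2 * π * a n * Real.exp (-(r^2 * n))) := by
    calc _ ≤ P * (K * r^3) := up
      _ = K/κ * (P * (κ * r^3)) := by field_simp
      _ ≤ _ := by gcongr
  have hpi := pi_pos
  have : (2 * π) * (a j * Real.exp (-(r^2 * j))) ≤ (2*π) * (K/κ * (a n * Real.exp (-(r^2 * n)))) := by linarith
  exact le_of_mul_le_mul_left this (by positivity)

end PartF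


section PartG
open Finset

theorem getD_lt_iff (l : List ℕ) (hl : l.Pairwise (· ≥ ·)) (i j : ℕ) :
    j < l.getD i 0 ↔ i < (l.filter (fun a => decide (j < a))).length := by
  induction l generalizing i with
  | nil => simp
  | cons a l ih =>
    rw [List.pairwise_cons] at hl
    have ih := ih hl.2
    by_cases ha : j < a
    · rw [List.filter_cons_of_pos (by simpa using ha)]
      cases i with
      | zero => simp [ha]
      | succ i => simpa using ih i
    · rw [List.filter_cons_of_neg (by simpa using ha)]
      have : l.filter (fun a => decide (j < a)) = [] := by
        rw [List.filter_eq_nil_iff]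
        intro b hb
        have := hl.1 b hb
        simp; omega
      cases i with
      | zero => simp [ha, this]
      | succ i =>
        have h := ih i
        rw [this] at h ⊢
        simpa using h

theorem sum_getD (l : List ℕ) (N : ℕ) (hN : l.length ≤ N) :
    ∑ i ∈ range N, l.getD i 0 = l.sum := by
  induction l generalizing N with
  | nil => simp
  | cons a l ih =>
    cases N with
    | zero => simp at hN
    | succ N =>
      rw [Finset.sum_range_succ']
      have := ih N (by simpa using hN)
      simp only [List.getD_cons_succ, List.getD_cons_zero, List.sum_cons]
      rw [this]; ring

theorem getD_inj (l1 l2 : List ℕ) (h1 : ∀ a ∈ l1, 0 < a) (h2 : ∀ a ∈ l2, 0 < a)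
    (h : ∀ i, l1.getD i 0 = l2.getD i 0) : l1 = l2 := by
  induction l1 generalizing l2 with
  | nil =>
    cases l2 with
    | nil => rfl
    | cons b l2 => have := h 0; have := h2 b (by simp); simp at *; omega
  | cons a l1 ih =>
    cases l2 with
    | nil => have := h 0; have := h1 a (by simp); simp at *; omega
    | cons b l2 =>
      have h0 := h 0
      simp only [List.getD_cons_zero] at h0
      rw [h0, ih l2 (fun a ha => h1 a (by simp [ha])) (fun a ha => h2 a (by simp [ha]))
        (fun i => by simpa using h (i+1))]

def rowList {n : ℕ} (μ : Nat.Partition n) : List ℕ := (μ.parts.sort (· ≤ ·)).reverse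

theorem rowList_coe {n : ℕ} (μ : Nat.Partition n) : ((rowList μ : List ℕ) : Multiset ℕ) = μ.parts := by
  rw [rowList, Multiset.coe_reverse, Multiset.sort_eq]

theorem rowList_pw {n : ℕ} (μ : Nat.Partition n) : (rowList μ).Pairwise (· ≥ ·) := by
  rw [rowList, List.pairwise_reverse]
  exact Multiset.pairwise_sort _ _

theorem row_col {n : ℕ} (μ : Nat.Partition n) (i j : ℕ) : j < rowLen μ i ↔ i < colLen μ j := by
  have := getD_lt_iff (rowList μ) (rowList_pw μ) i j
  have e : colLen μ j = ((rowList μ).filter (fun a => decide (j < a))).length := by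
    rw [colLen, ← rowList_coe, Multiset.filter_coe, Multiset.coe_card]
  rw [e]; exact this

theorem rowList_pos {n : ℕ} (μ : Nat.Partition n) : ∀ a ∈ rowList μ, 0 < a := by
  intro a ha
  apply μ.parts_pos
  rw [← rowList_coe]; exact ha

theorem rowList_sum {n : ℕ} (μ : Nat.Partition n) : (rowList μ).sum = n := by
  have := μ.parts_sum
  rw [← rowList_coe, Multiset.sum_coe] at this
  exact this

theorem length_le_sum (l : List ℕ) (h : ∀ a ∈ l, 0 < a) : l.length ≤ l.sum := by
  induction l with
  | nil => simp
  | cons a l ih =>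
    have := ih (fun a ha => h a (by simp [ha]))
    have := h a (by simp)
    simp; omega

theorem rowList_len {n : ℕ} (μ : Nat.Partition n) : (rowList μ).length ≤ n :=
  (length_le_sum _ (rowList_pos μ)).trans (rowList_sum μ).le

theorem rowLen_eq {n : ℕ} (μ : Nat.Partition n) (i : ℕ) : rowLen μ i = (rowList μ).getD i 0 := rfl

theorem rowLen_sum {n : ℕ} (μ : Nat.Partition n) : ∑ i ∈ range n, rowLen μ i = n := by
  simp_rw [rowLen_eq]
  rw [sum_getD _ _ (rowList_len μ), rowList_sum]

theorem rowLen_zero {n : ℕ} (μ : Nat.Partition n) (i : ℕ) (hi : n ≤ i) : rowLen μ i = 0 := by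
  rw [rowLen_eq, List.getD_eq_default]
  exact (rowList_len μ).trans hi

theorem rowLen_inj {n : ℕ} (μ ν : Nat.Partition n) (h : ∀ i < n, rowLen μ i = rowLen ν i) : μ = ν := by
  have : rowList μ = rowList ν := by
    refine getD_inj _ _ (rowList_pos μ) (rowList_pos ν) fun i => ?_
    by_cases hi : i < n
    · exact h i hi
    · rw [← rowLen_eq, ← rowLen_eq, rowLen_zero μ i (by omega), rowLen_zero ν i (by omega)]
  ext1
  rw [← rowList_coe, ← rowList_coe, this]

theorem rowLen_anti {n : ℕ} (μ : Nat.Partition n) {i i' : ℕ} (h : i ≤ i') : rowLen μ i' ≤ rowLen μ i := by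
  by_contra hc
  push Not at hc
  have h1 := (row_col μ i' (rowLen μ i)).mp hc
  have h2 := (row_col μ i (rowLen μ i)).mpr (by omega)
  omega

/-- the beta function, increasing -/
def bet {n : ℕ} (μ : Nat.Partition n) (i : Fin n) : ℕ := rowLen μ (n - 1 - i) + i

theorem bet_mono {n : ℕ} (μ : Nat.Partition n) : StrictMono (bet μ) := by
  intro i j hij
  have h : (i:ℕ) < j := hij
  have := rowLen_anti μ (i := n - 1 - j) (i' := n - 1 - i) (by omega)
  unfold bet
  omega

def betaSet {n : ℕ} (μ : Nat.Partition n) : Finset ℕ := univ.image (bet μ)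

theorem betaSet_card {n : ℕ} (μ : Nat.Partition n) : (betaSet μ).card = n := by
  rw [betaSet, card_image_of_injective _ (bet_mono μ).injective]; simp

theorem betaSet_sum {n : ℕ} (μ : Nat.Partition n) : ∑ a ∈ betaSet μ, a = n + ∑ i ∈ range n, i := by
  rw [betaSet, sum_image (fun a _ b _ h => (bet_mono μ).injective h)]
  unfold bet
  rw [Finset.sum_add_distrib, ← Finset.sum_range (fun i => rowLen μ (n - 1 - i)), ← Finset.sum_range (fun i => i),
    Finset.sum_range_reflect (fun i => rowLen μ i), rowLen_sum]

theorem betaSet_inj {n : ℕ} : Function.Injective (betaSet (n := n)) := by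
  intro μ ν h
  have h2 : Set.range (bet μ) = Set.range (bet ν) := by
    have := congrArg (fun S : Finset ℕ => (S : Set ℕ)) h
    simpa [betaSet] using this
  rw [StrictMono.range_inj (bet_mono μ) (bet_mono ν)] at h2
  refine rowLen_inj μ ν fun i hi => ?_
  have := congrFun h2 ⟨n - 1 - i, by omega⟩
  simp only [bet] at this
  rw [show n - 1 - (n - 1 - i) = i by omega] at this
  omega

def Bad (t : ℕ) (S : Finset ℕ) : Prop := ∃ b ∈ S, ∃ l, 1 ≤ l ∧ l * t ≤ b ∧ b - l * t ∉ S

theorem bad_of_not_core {n t : ℕ} (μ : Nat.Partition n) (h : ¬ IsTCore t μ) : Bad t (betaSet μ) := by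
  unfold IsTCore at h
  push Not at h
  obtain ⟨i, j, hij, hd⟩ := h
  have hc := (row_col μ i j).mp hij
  have hn : ∀ i', i' < colLen μ j → i' < n := by
    intro i' h'
    by_contra hh
    have := (row_col μ i' j).mpr h'
    rw [rowLen_zero μ i' (by omega)] at this
    omega
  have hcn : colLen μ j ≤ n := by
    by_contra hh
    have := hn n (by omega)
    omega
  have hin := hn i hc
  obtain ⟨l, hl⟩ := hd
  unfold hookLen at hl
  refine ⟨rowLen μ i + (n - 1 - i), ?_, l, ?_, ?_, ?_⟩
  · rw [betaSet, mem_image]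
    refine ⟨⟨n - 1 - i, by omega⟩, mem_univ _, ?_⟩
    simp only [bet]
    rw [show n - 1 - (n - 1 - i) = i by omega]
  · rcases Nat.eq_zero_or_pos l with h0 | h0
    · rw [h0] at hl; omega
    · exact h0
  · rw [mul_comm, ← hl]; omega
  · rw [mul_comm, ← hl, betaSet, mem_image]
    rintro ⟨⟨a, ha⟩, -, hb⟩
    simp only [bet] at hb
    have := row_col μ (n - 1 - a) j
    by_cases hx : n - 1 - a < colLen μ j
    · have := this.mpr hx; omega
    · have : ¬ (j < rowLen μ (n - 1 - a)) := fun hh => hx (this.mp hh)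
      omega

def FF (N m : ℕ) : Finset (Finset ℕ) :=
  ((range (m + ∑ i ∈ range N, i + 1)).powersetCard N).filter (fun S => ∑ a ∈ S, a = m + ∑ i ∈ range N, i)

theorem mem_FF (N m : ℕ) (S : Finset ℕ) : S ∈ FF N m ↔ S.card = N ∧ ∑ a ∈ S, a = m + ∑ i ∈ range N, i := by
  rw [FF, mem_filter, mem_powersetCard]
  constructor
  · rintro ⟨⟨_, h1⟩, h2⟩; exact ⟨h1, h2⟩
  · rintro ⟨h1, h2⟩
    refine ⟨⟨fun a ha => ?_, h1⟩, h2⟩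
    have := Finset.single_le_sum (f := fun a : ℕ => a) (fun _ _ => Nat.zero_le _) ha
    rw [mem_range]; omega

theorem emb_ge {N : ℕ} (s : Fin N → ℕ) (hs : StrictMono s) (i : Fin N) : (i:ℕ) ≤ s i := by
  obtain ⟨k, hk⟩ := i
  induction k with
  | zero => simp
  | succ k ih =>
    have := ih (by omega)
    have h2 : s ⟨k, by omega⟩ < s ⟨k+1, hk⟩ := hs (by simp)
    simp only at *
    omega

theorem emb_gap {N : ℕ} (s : Fin N → ℕ) (hs : StrictMono s) : Monotone (fun i : Fin N => s i - i) := by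
  have key : ∀ d k (hk : k + d < N), s ⟨k, by omega⟩ + d ≤ s ⟨k + d, hk⟩ := by
    intro d
    induction d with
    | zero => intro k hk; simp
    | succ d ih =>
      intro k hk
      have h1 := ih k (by omega)
      have h2 : s ⟨k + d, by omega⟩ < s ⟨k + (d + 1), hk⟩ := hs (by simp)
      omega
  intro i j hij
  have hij' : (i:ℕ) ≤ j := hij
  have := key (j - i) i (by omega)
  have e : (⟨(i:ℕ) + (j - i), by omega⟩ : Fin N) = j := by ext; simp; omega
  rw [e] at this
  simp only [Fin.eta] at this
  simp only
  omega

theorem emb_sum {N : ℕ} (S : Finset ℕ) (h : S.card = N) : ∑ i : Fin N, (S.orderEmbOfFin h i) = ∑ a ∈ S, a := by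
  have := Finset.image_orderEmbOfFin_univ S h
  conv_rhs => rw [← this]
  rw [sum_image (fun a _ b _ hh => (S.orderEmbOfFin h).injective hh)]

theorem emb_sum_sub {N : ℕ} (S : Finset ℕ) (h : S.card = N) :
    ∑ i : Fin N, (S.orderEmbOfFin h i - i) + ∑ i ∈ range N, i = ∑ a ∈ S, a := by
  rw [← emb_sum S h, Finset.sum_range (fun i => i), ← Finset.sum_add_distrib]
  refine sum_congr rfl fun i _ => ?_
  have := emb_ge _ (S.orderEmbOfFin h).strictMono i
  omega

theorem sum_ge_of_card {N : ℕ} (S : Finset ℕ) (h : S.card = N) : ∑ i ∈ range N, i ≤ ∑ a ∈ S, a := by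
  rw [← emb_sum_sub S h]; omega

theorem FF_card (N m : ℕ) : (FF N m).card ≤ Nat.card (Nat.Partition m) := by
  rw [Nat.card_eq_fintype_card, ← Finset.card_univ]
  have hc : ∀ S : FF N m, (S:Finset ℕ).card = N := fun S => ((mem_FF N m S).mp S.2).1
  let G : FF N m → List ℕ := fun S => List.ofFn (fun i : Fin N => (S:Finset ℕ).orderEmbOfFin (hc S) i - i)
  have hG : ∀ S, (G S : Multiset ℕ).sum = m := by
    intro S
    have h1 := emb_sum_sub (S:Finset ℕ) (hc S)
    have h2 := ((mem_FF N m S).mp S.2).2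
    rw [Multiset.sum_coe, List.sum_ofFn]
    omega
  rw [← Fintype.card_coe (FF N m), ← Finset.card_univ]
  refine Finset.card_le_card_of_injOn (fun S => Nat.Partition.ofSums m (G S : Multiset ℕ) (hG S)) (fun _ _ => mem_univ _) ?_
  intro S _ T _ hST
  have h1 : ((G S : Multiset ℕ)).filter (· ≠ 0) = ((G T : Multiset ℕ)).filter (· ≠ 0) :=
    congrArg Nat.Partition.parts hST
  have h2 : (G S : Multiset ℕ) = (G T : Multiset ℕ) := by
    ext a
    have hcnt : ∀ b, b ≠ 0 → Multiset.count b (G S : Multiset ℕ) = Multiset.count b (G T : Multiset ℕ) := by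
      intro b hb
      have := congrArg (Multiset.count b) h1
      rwa [Multiset.count_filter_of_pos (p := fun x : ℕ => x ≠ 0) hb, Multiset.count_filter_of_pos (p := fun x : ℕ => x ≠ 0) hb] at this
    by_cases ha : a = 0
    · subst ha
      have e1 := congrArg Multiset.card h1
      have c1 : ∀ U : FF N m, Multiset.card ((G U : Multiset ℕ).filter (· ≠ 0)) + Multiset.count 0 (G U : Multiset ℕ) = N := by
        intro U
        have := Multiset.card_eq_countP_add_countP (fun a : ℕ => a ≠ 0) (G U : Multiset ℕ)
        rw [Multiset.countP_eq_card_filter] at this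
        have e2 : Multiset.card (G U : Multiset ℕ) = N := by simp [G]
        rw [Multiset.count, ← e2, this]
        congr 1
        refine Multiset.countP_congr rfl ?_
        intro x _; simp [eq_comm]
      have := c1 S
      have := c1 T
      omega
    · exact hcnt a ha
  have h3 : G S = G T := by
    have hp : (G S).Perm (G T) := Multiset.coe_eq_coe.mp h2
    refine List.Perm.eq_of_pairwise (le := (· ≤ ·)) (fun a b _ _ h h' => le_antisymm h h') ?_ ?_ hp
    · exact List.pairwise_ofFn.mpr fun i j hij => emb_gap _ ((S:Finset ℕ).orderEmbOfFin (hc S)).strictMono hij.le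
    · exact List.pairwise_ofFn.mpr fun i j hij => emb_gap _ ((T:Finset ℕ).orderEmbOfFin (hc T)).strictMono hij.le
  have h4 := List.ofFn_injective h3
  have h5 : ∀ i, (S:Finset ℕ).orderEmbOfFin (hc S) i = (T:Finset ℕ).orderEmbOfFin (hc T) i := by
    intro i
    have a1 := congrFun h4 i
    have a2 := emb_ge _ ((S:Finset ℕ).orderEmbOfFin (hc S)).strictMono i
    have a3 := emb_ge _ ((T:Finset ℕ).orderEmbOfFin (hc T)).strictMono i
    omega
  ext1
  rw [← Finset.image_orderEmbOfFin_univ _ (hc S), ← Finset.image_orderEmbOfFin_univ _ (hc T)]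
  refine Finset.image_congr fun i _ => h5 i

def Spec (t : ℕ) (S : Finset ℕ) (r k x : ℕ) (S' : Finset ℕ) : Prop :=
  r < t ∧ 1 ≤ k ∧ k * t ≤ x ∧ x % t = r ∧ x ∈ S ∧ x - k * t ∉ S ∧ S' = insert (x - k * t) (S.erase x) ∧
  (∀ y ∈ S, y % t = r → y ≤ x) ∧ (∀ l, 1 ≤ l → l < k → x - l * t ∈ S)

theorem spec_exists (t : ℕ) (ht : 0 < t) (S : Finset ℕ) (h : Bad t S) : ∃ r k x S', Spec t S r k x S' := by
  obtain ⟨b, hb, l, hl, hlb, hn⟩ := h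
  have hne : (S.filter (fun y => y % t = b % t)).Nonempty := ⟨b, by simp [hb]⟩
  set x := (S.filter (fun y => y % t = b % t)).max' hne with hx
  have hxm := Finset.max'_mem _ hne
  rw [← hx, mem_filter] at hxm
  have hmax : ∀ y ∈ S, y % t = b % t → y ≤ x := fun y hy hy2 => Finset.le_max' _ _ (by simp [hy, hy2])
  have hbx := hmax b hb rfl
  have hdvd : t ∣ x - b := (Nat.modEq_iff_dvd' hbx).mp hxm.2.symm
  obtain ⟨u, hu⟩ := hdvd
  have hxe : x = b + u * t := by rw [mul_comm u t, ← hu]; omega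
  have ex : ∃ k, 1 ≤ k ∧ k * t ≤ x ∧ x - k * t ∉ S := by
    refine ⟨u + l, by omega, ?_, ?_⟩
    · rw [add_mul]; omega
    · rw [add_mul, show x - (u * t + l * t) = b - l * t by omega]; exact hn
  classical
  obtain ⟨h1, h2, h3⟩ := Nat.find_spec ex
  refine ⟨b % t, Nat.find ex, x, _, Nat.mod_lt _ ht, h1, h2, hxm.2, hxm.1, h3, rfl, hmax, fun l' hl1 hl2 => ?_⟩
  have := Nat.find_min ex hl2
  by_contra hc
  refine this ⟨hl1, ?_, hc⟩
  exact le_trans (Nat.mul_le_mul_right t hl2.le) h2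

theorem mod_lt_le {t x y : ℕ} (h : y % t = x % t) (hlt : y < x) : y + t ≤ x := by
  have hdvd : t ∣ x - y := (Nat.modEq_iff_dvd' hlt.le).mp h
  have := Nat.le_of_dvd (by omega) hdvd
  omega

theorem spec_x_le (t : ℕ) (ht : 0 < t) (S1 S2 : Finset ℕ) (r k x1 x2 : ℕ) (S' : Finset ℕ)
    (h1 : Spec t S1 r k x1 S') (h2 : Spec t S2 r k x2 S') : x1 ≤ x2 := by
  obtain ⟨hr, hk, hkx, hxr, hxS, hxn, hS', hmax, hmin⟩ := h1
  obtain ⟨hr2, hk2, hkx2, hxr2, hxS2, hxn2, hS'2, hmax2, hmin2⟩ := h2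
  have htk : t ≤ k * t := Nat.le_mul_of_pos_left t hk
  have m1 : x1 - t ∈ S' := by
    rw [hS', mem_insert]
    rcases Nat.lt_or_ge 1 k with h | h
    · right
      have := hmin 1 le_rfl h
      rw [one_mul] at this
      rw [mem_erase]
      exact ⟨by omega, this⟩
    · left
      have : k = 1 := by omega
      rw [this, one_mul]
  have c1 : (x1 - t) % t = r := by
    rw [← hxr, ← Nat.mod_eq_sub_mod (by omega)]
  rw [hS'2, mem_insert] at m1
  rcases m1 with m1 | m1
  · omega
  · rw [mem_erase] at m1
    have hle := hmax2 _ m1.2 c1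
    have hlt : x1 - t < x2 := by omega
    have := mod_lt_le (c1.trans hxr2.symm) hlt
    omega

theorem spec_inj (t : ℕ) (ht : 0 < t) (S1 S2 : Finset ℕ) (r k x1 x2 : ℕ) (S' : Finset ℕ)
    (h1 : Spec t S1 r k x1 S') (h2 : Spec t S2 r k x2 S') : S1 = S2 := by
  have hx : x1 = x2 := le_antisymm (spec_x_le t ht S1 S2 r k x1 x2 S' h1 h2) (spec_x_le t ht S2 S1 r k x2 x1 S' h2 h1)
  subst hx
  have hrec : ∀ S, Spec t S r k x1 S' → S = insert x1 (S'.erase (x1 - k * t)) := by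
    rintro S ⟨hr, hk, hkx, hxr, hxS, hxn, hS', hmax, hmin⟩
    rw [hS', erase_insert (fun h => hxn (mem_of_mem_erase h)), insert_erase hxS]
  rw [hrec S1 h1, hrec S2 h2]

theorem spec_card_sum (t : ℕ) (S : Finset ℕ) (r k x : ℕ) (S' : Finset ℕ) (h : Spec t S r k x S') :
    S'.card = S.card ∧ ∑ a ∈ S', a + k * t = ∑ a ∈ S, a := by
  obtain ⟨hr, hk, hkx, hxr, hxS, hxn, hS', hmax, hmin⟩ := h
  have hnm : x - k * t ∉ S.erase x := fun h => hxn (mem_of_mem_erase h)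
  rw [hS']
  constructor
  · rw [card_insert_of_notMem hnm, card_erase_add_one hxS]
  · rw [sum_insert hnm]
    have := Finset.add_sum_erase S (fun a => a) hxS
    omega

theorem noncore_count (n t : ℕ) (ht : 0 < t) :
    Nat.card {μ : Nat.Partition n // ¬ IsTCore t μ} ≤
      t * ∑ k ∈ (Icc 1 n).filter (fun k => k * t ≤ n), Nat.card (Nat.Partition (n - k * t)) := by
  classical
  have hex : ∀ μ : {μ : Nat.Partition n // ¬ IsTCore t μ}, ∃ r k x S', Spec t (betaSet μ.1) r k x S' :=
    fun μ => spec_exists t ht _ (bad_of_not_core μ.1 μ.2)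
  choose r k x S' hs using hex
  let T : Finset (ℕ × (Σ _ : ℕ, Finset ℕ)) :=
    (range t) ×ˢ (((Icc 1 n).filter (fun k => k * t ≤ n)).sigma (fun k => FF n (n - k * t)))
  have hT : T.card ≤ t * ∑ k ∈ (Icc 1 n).filter (fun k => k * t ≤ n), Nat.card (Nat.Partition (n - k * t)) := by
    rw [card_product, card_range, card_sigma]
    exact Nat.mul_le_mul_left _ (sum_le_sum fun k _ => FF_card _ _)
  refine le_trans ?_ hT
  rw [Nat.card_eq_fintype_card, ← Finset.card_univ]
  refine Finset.card_le_card_of_injOn (fun μ => (r μ, ⟨k μ, S' μ⟩)) ?_ ?_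
  · intro μ _
    obtain ⟨c1, c2⟩ := spec_card_sum _ _ _ _ _ _ (hs μ)
    have hsp := hs μ
    obtain ⟨hr, hk, -⟩ := hsp
    rw [betaSet_card] at c1
    rw [betaSet_sum] at c2
    have c3 := sum_ge_of_card _ c1
    have hkn : k μ * t ≤ n := by omega
    have hkn2 : k μ ≤ n := le_trans (Nat.le_mul_of_pos_right _ ht) hkn
    simp only [T, coe_product, Set.mem_prod, mem_coe, mem_range, mem_sigma, mem_filter, mem_Icc, mem_FF]
    exact ⟨hr, ⟨⟨hk, hkn2⟩, hkn⟩, c1, by omega⟩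
  · intro μ _ ν _ h
    simp only [Prod.mk.injEq, Sigma.mk.injEq, heq_eq_eq] at h
    obtain ⟨h1, h2, h3⟩ := h
    have hν := hs ν
    rw [← h1, ← h2, ← h3] at hν
    have := spec_inj t ht _ _ _ _ _ _ _ (hs μ) hν
    exact Subtype.ext (betaSet_inj this)

end PartG

section PartH

theorem core_add_noncore (n t : ℕ) : (Nat.card {μ : Nat.Partition n // IsTCore t μ}) +
    Nat.card {μ : Nat.Partition n // ¬ IsTCore t μ} = Nat.card (Nat.Partition n) := by
  classical
  rw [← Nat.card_sum]
  exact Nat.card_congr (Equiv.sumCompl (fun μ : Nat.Partition n => IsTCore t μ))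

theorem geom_Icc (q : ℝ) (hq : 0 ≤ q) (hq1 : q ≤ 3/4) (n : ℕ) : ∑ k ∈ Finset.Icc 1 n, q^k ≤ 4 * q := by
  have h : ∑ k ∈ Finset.Icc 1 n, q^k ≤ 4 * q - 4 * q ^ (n+1) := by
    induction n with
    | zero => simp
    | succ n ih =>
      rw [Finset.sum_Icc_succ_top (by omega)]
      have h1 : q^(n+1+1) = q^(n+1) * q := pow_succ _ _
      have h2 : 0 ≤ q^(n+1) := by positivity
      nlinarith
  have : 0 ≤ q^(n+1) := by positivity
  linarith

theorem noncore_real (C0 r0 : ℝ) (hC0 : 0 < C0) (hr0 : 0 < r0)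
    (H : ∀ r, 0 < r → r ≤ r0 → ∀ n : ℕ, (n:ℝ) = π^2/6/(r^2)^2 →
    ∀ j ≤ n, (Nat.card (Nat.Partition j) : ℝ) * Real.exp (-(r^2 * j)) ≤
      C0 * ((Nat.card (Nat.Partition n) : ℝ) * Real.exp (-(r^2 * n))))
    (n t : ℕ) (M : ℝ) (hn : 2 ≤ n) (hM : 0 ≤ M) (hM2 : M ≤ 10 * Real.log n)
    (ht : (t : ℝ) = Real.sqrt 6 / (2 * π) * Real.sqrt n * Real.log n +
          Real.sqrt 6 / π * M * Real.sqrt n) (hbig : π^2/6/(r0^2)^2 ≤ n) :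
    (Nat.card {μ : Nat.Partition n // ¬ IsTCore t μ} : ℝ) ≤
      (Nat.card (Nat.Partition n) : ℝ) * (44 * C0 * Real.log n / Real.exp M) := by
  have hpi := pi_pos
  have hn' : (2:ℝ) ≤ n := by exact_mod_cast hn
  have hn0 : (0:ℝ) < n := by linarith
  have hlog : 0 < Real.log n := Real.log_pos (by linarith)
  have hsn : 0 < √(n:ℝ) := Real.sqrt_pos.mpr hn0
  have hs6 : 0 < √(6:ℝ) := by positivity
  have hsn2 : √(n:ℝ)^2 = n := Real.sq_sqrt hn0.le
  have hs62 : √(6:ℝ)^2 = 6 := Real.sq_sqrt (by norm_num)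
  have htpos : (0:ℝ) < t := by rw [ht]; positivity
  have htn : 0 < t := by exact_mod_cast htpos
  set x : ℝ := π / (√6 * √n) with hx
  have hx0 : 0 < x := by positivity
  have hx2 : x^2 = π^2/6/n := by
    rw [hx, div_pow, mul_pow, hsn2, hs62]; field_simp
  set r := √x with hr
  have hrr : r^2 = x := Real.sq_sqrt hx0.le
  have hrpos : 0 < r := Real.sqrt_pos.mpr hx0
  have hrle : r ≤ r0 := by
    have : x ≤ r0^2 := by
      refine le_of_sq_le_sq ?_ (by positivity)
      rw [hx2, div_le_iff₀ hn0]
      rw [div_le_iff₀ (by positivity)] at hbig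
      linarith
    rw [← hrr] at this
    exact le_of_sq_le_sq this hr0.le
  have hne : (n:ℝ) = π^2/6/(r^2)^2 := by
    rw [hrr, hx2]; field_simp
  have hxt : x * t = Real.log n / 2 + M := by
    rw [ht, hx]; field_simp
  set q := Real.exp (-(x*t)) with hq
  have hqe : q = 1 / (√n * Real.exp M) := by
    rw [hq, hxt, Real.exp_neg, Real.exp_add, Real.exp_half, Real.exp_log hn0, one_div]
  have hq0 : 0 ≤ q := Real.exp_nonneg _
  have hs14 : (4/3:ℝ) ≤ √n := Real.le_sqrt_of_sq_le (by linarith)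
  have heM : 1 ≤ Real.exp M := Real.one_le_exp hM
  have hq1 : q ≤ 3/4 := by
    rw [hqe, div_le_iff₀ (by positivity)]
    nlinarith
  have hp : ∀ k : ℕ, k * t ≤ n → (Nat.card (Nat.Partition (n - k * t)) : ℝ) ≤
      C0 * (Nat.card (Nat.Partition n) : ℝ) * q ^ k := by
    intro k hk
    have h := H r hrpos hrle n hne (n - k * t) (Nat.sub_le _ _)
    rw [hrr, Nat.cast_sub hk] at h
    have e : Real.exp (-(x * n)) = Real.exp (-(x * ((n:ℝ) - ((k * t : ℕ):ℝ)))) * q^k := by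
      rw [hq, ← Real.exp_nat_mul, ← Real.exp_add]
      congr 1; push_cast; ring
    rw [e] at h
    refine le_of_mul_le_mul_right (le_of_le_of_eq h ?_) (Real.exp_pos (-(x * ((n:ℝ) - ((k * t : ℕ):ℝ)))))
    ring
  have h1 : (Nat.card {μ : Nat.Partition n // ¬ IsTCore t μ} : ℝ) ≤
      t * ∑ k ∈ (Finset.Icc 1 n).filter (fun k => k * t ≤ n), (Nat.card (Nat.Partition (n - k * t)) : ℝ) := by
    exact_mod_cast noncore_count n t htn
  set p : ℝ := (Nat.card (Nat.Partition n) : ℝ) with hpdef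
  have hp0 : 0 ≤ p := Nat.cast_nonneg _
  have h2 : ∑ k ∈ (Finset.Icc 1 n).filter (fun k => k * t ≤ n), (Nat.card (Nat.Partition (n - k * t)) : ℝ) ≤
      C0 * p * (4 * q) := by
    calc _ ≤ ∑ k ∈ (Finset.Icc 1 n).filter (fun k => k * t ≤ n), C0 * p * q^k :=
          Finset.sum_le_sum fun k hk => hp k (Finset.mem_filter.mp hk).2
      _ ≤ ∑ k ∈ Finset.Icc 1 n, C0 * p * q^k :=
          Finset.sum_le_sum_of_subset_of_nonneg (Finset.filter_subset _ _) fun k _ _ => by positivity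
      _ = C0 * p * ∑ k ∈ Finset.Icc 1 n, q^k := by rw [Finset.mul_sum]
      _ ≤ _ := by gcongr; exact geom_Icc q hq0 hq1 n
  have ht2 : (t:ℝ) ≤ 11 * √n * Real.log n := by
    have h6 : √6 / π ≤ 1 := by
      rw [div_le_one hpi]
      have : √(6:ℝ) ≤ 3 := Real.sqrt_le_iff.mpr ⟨by norm_num, by norm_num⟩
      linarith [Real.pi_gt_three]
    have e : (t:ℝ) = √6 / π * (√n * (Real.log n / 2 + M)) := by rw [ht]; field_simp
    rw [e]
    calc _ ≤ 1 * (√n * (Real.log n / 2 + M)) := by gcongr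
      _ ≤ 1 * (√n * (11 * Real.log n)) := by gcongr; linarith
      _ = _ := by ring
  calc _ ≤ (t:ℝ) * (C0 * p * (4 * q)) := h1.trans (by gcongr)
    _ ≤ (11 * √n * Real.log n) * (C0 * p * (4 * q)) := by gcongr
    _ = _ := by rw [hqe]; field_simp; ring

end PartH

/-- If `t = (√6/(2π))√n·log n + (√6/π)·M·√n` with `0 ≤ M ≤ 10 log n`, then the number of
`t`-core partitions of `n` is at least `p(n)·(1 - O(log n / e^M))`. -/
theorem count_tcore_ge_asymptotic :
    ∃ C : ℝ, 0 < C ∧ ∀ n t : ℕ, ∀ M : ℝ, 2 ≤ n → 0 ≤ M → M ≤ 10 * Real.log n →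
      (t : ℝ) = Real.sqrt 6 / (2 * π) * Real.sqrt n * Real.log n +
          Real.sqrt 6 / π * M * Real.sqrt n →
      (Nat.card {μ : Nat.Partition n // IsTCore t μ} : ℝ) ≥
        (Nat.card (Nat.Partition n) : ℝ) * (1 - C * Real.log n / Real.exp M) := by
  obtain ⟨C0, hC0, r0, hr0, H⟩ := ratio_bound
  set n0 : ℝ := π^2/6/(r0^2)^2 with hn0
  have hlog2 : 0 < Real.log 2 := Real.log_pos (by norm_num)
  refine ⟨44 * C0 + Real.exp (10 * Real.log n0) / Real.log 2, by positivity, ?_⟩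
  intro n t M hn hM hM2 ht
  have hn' : (2:ℝ) ≤ n := by exact_mod_cast hn
  have hlogn : Real.log 2 ≤ Real.log n := Real.log_le_log (by norm_num) hn'
  have hlog : 0 < Real.log n := hlog2.trans_le hlogn
  have hp0 : (0:ℝ) ≤ (Nat.card (Nat.Partition n) : ℝ) := Nat.cast_nonneg _
  by_cases hbig : n0 ≤ n
  · have h1 := noncore_real C0 r0 hC0 hr0 H n t M hn hM hM2 ht hbig
    have h2 : (Nat.card {μ : Nat.Partition n // IsTCore t μ} : ℝ) +
      (Nat.card {μ : Nat.Partition n // ¬ IsTCore t μ} : ℝ) = (Nat.card (Nat.Partition n) : ℝ) := by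
      exact_mod_cast core_add_noncore n t
    have h3 : (Nat.card (Nat.Partition n) : ℝ) * (44 * C0 * Real.log n / Real.exp M) ≤
        (Nat.card (Nat.Partition n) : ℝ) *
          ((44 * C0 + Real.exp (10 * Real.log n0) / Real.log 2) * Real.log n / Real.exp M) := by
      gcongr
      have : 0 ≤ Real.exp (10 * Real.log n0) / Real.log 2 := by positivity
      linarith
    rw [mul_sub, mul_one]
    linarith
  · push Not at hbig
    have h1 : Real.exp M ≤ Real.exp (10 * Real.log n0) := by
      apply Real.exp_le_exp.mpr
      have := Real.log_le_log (by linarith) hbig.le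
      linarith
    have h2 : 1 ≤ (44 * C0 + Real.exp (10 * Real.log n0) / Real.log 2) * Real.log n / Real.exp M := by
      rw [le_div_iff₀ (Real.exp_pos _), one_mul]
      calc Real.exp M ≤ Real.exp (10 * Real.log n0) := h1
        _ = Real.exp (10 * Real.log n0) / Real.log 2 * Real.log 2 := by field_simp
        _ ≤ (44 * C0 + Real.exp (10 * Real.log n0) / Real.log 2) * Real.log n := by
          gcongr
          linarith
    have h3 : (Nat.card (Nat.Partition n) : ℝ) *
        (1 - (44 * C0 + Real.exp (10 * Real.log n0) / Real.log 2) * Real.log n / Real.exp M) ≤ 0 :=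
      mul_nonpos_of_nonneg_of_nonpos hp0 (by linarith)
    exact h3.trans (Nat.cast_nonneg _)
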